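/- arXiv:1410.7078 — 2 statements merged into one kernel-verified Lean document; each statement's English description precedes it below -/
import Mathlib

section
/- Let F be an algebraically closed field of characteristic different from 2, 3 and 5, and let (U, ω) be a finite-dimensional b-alternative algebra over F with a multiplicative unity element 1. Then there exist a b-semisimple b-subalgebra S of U and a vector subspace V of bar(U) such that U = S ⊕ V ⊕ rad(U) as a direct sum of vector spaces, V·V ⊆ rad(U), bar(S) is a semisimple algebra (its only nil two-sided ideal is zero), and V ⊕ rad(U) is a nil two-sided ideal of bar(U). -/
/-! Wedderburn b-decomposition for finite-dimensional unital b-alternative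
algebras: the semisimple part has semisimple bar ideal and `V ⊕ rad(U)` is a
nil ideal of `bar(U)`. -/

section BaricDefs

variable (F : Type*) [Field F] (U : Type*) [NonUnitalNonAssocRing U]
  [Module F U] [SMulCommClass F U U] [IsScalarTower F U U]
  (ω : U →ₗ[F] F)

/-- The bar set of a subalgebra `B`: elements of `B` of weight zero. -/
def barSet (B : NonUnitalSubalgebra F U) : Set U := {x | x ∈ B ∧ ω x = 0}

/-- `B` is a b-subalgebra: a subalgebra not contained in the kernel of the weight. -/
def IsBSubalgebra (B : NonUnitalSubalgebra F U) : Prop := ∃ x ∈ B, ω x ≠ 0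

/-- `B` is a normal b-subalgebra: a b-subalgebra whose bar set is a two-sided
ideal of the whole algebra `U`. -/
def IsNormalBSubalgebra (B : NonUnitalSubalgebra F U) : Prop :=
  IsBSubalgebra F U ω B ∧
    ∀ x ∈ barSet F U ω B, ∀ u : U, u * x ∈ barSet F U ω B ∧ x * u ∈ barSet F U ω B

/-- `B` is a maximal normal b-subalgebra: normal, and no normal b-subalgebra lies
strictly between `B` and `U`. -/
def IsMaximalNormalBSubalgebra (B : NonUnitalSubalgebra F U) : Prop :=
  IsNormalBSubalgebra F U ω B ∧
    ¬ ∃ C : NonUnitalSubalgebra F U, IsNormalBSubalgebra F U ω C ∧ B < C ∧ C < ⊤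

/-- `(U, ω)` is b-simple: every normal b-subalgebra has bar set `(0)` or `bar(U)`. -/
def IsBSimple : Prop :=
  ∀ B : NonUnitalSubalgebra F U, IsNormalBSubalgebra F U ω B →
    barSet F U ω B = {0} ∨ barSet F U ω B = {x : U | ω x = 0}

open Classical in
/-- The b-radical of `(U, ω)`: `(0)` if `(U, ω)` is b-simple, and otherwise the
intersection of the bar sets of the maximal normal b-subalgebras. -/
noncomputable def bRad : Set U :=
  if IsBSimple F U ω then {0}
  else ⋂ B ∈ {B : NonUnitalSubalgebra F U | IsMaximalNormalBSubalgebra F U ω B},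
    barSet F U ω B

/-- The inclusion of a subalgebra as a linear map. -/
def subalgebraIncl (S : NonUnitalSubalgebra F U) : ↥S →ₗ[F] U where
  toFun := Subtype.val
  map_add' _ _ := rfl
  map_smul' _ _ := rfl

/-- A b-subalgebra `S` is b-semisimple when `(S, ω|_S)` is a b-algebra with zero
b-radical. -/
noncomputable def IsBSemisimpleSubalgebra (S : NonUnitalSubalgebra F U) : Prop :=
  IsBSubalgebra F U ω S ∧ bRad F ↥S (ω.comp (subalgebraIncl F U S)) = {0}

end BaricDefs

/-- Left powers: `lpow x n = x^(n+1)`.  In an alternative (hence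
power-associative) ring powers of a single element are unambiguous. -/
def lpow {U : Type*} [Mul U] (x : U) : ℕ → U
  | 0 => x
  | n + 1 => x * lpow x n

/-- An element is nil(potent) if some power of it vanishes. -/
def IsNilElem {U : Type*} [Mul U] [Zero U] (x : U) : Prop := ∃ n : ℕ, lpow x n = 0

/-- The left and right alternative laws. -/
def IsAlternative (U : Type*) [Mul U] : Prop :=
  ∀ x y : U, (x * x) * y = x * (x * y) ∧ (y * x) * x = y * (x * x)

namespace IsAlternative

section Identities

variable {U : Type*} [NonUnitalNonAssocRing U] (h : IsAlternative U)
include h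

theorem left_lin (x y z : U) : (x * y) * z + (y * x) * z = x * (y * z) + y * (x * z) := by
  have h1 := (h (x + y) z).1
  have h2 := (h x z).1
  have h3 := (h y z).1
  simp only [add_mul, mul_add] at h1
  rw [h2, h3] at h1
  rw [← sub_eq_zero] at h1 ⊢
  rw [← h1]; abel

theorem right_lin (x y z : U) : (z * x) * y + (z * y) * x = z * (x * y) + z * (y * x) := by
  have h1 := (h (x + y) z).2
  have h2 := (h x z).2
  have h3 := (h y z).2
  simp only [add_mul, mul_add] at h1
  rw [h2, h3] at h1
  rw [← sub_eq_zero] at h1 ⊢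
  rw [← h1]; abel

theorem associator_swap_left (x y z : U) : associator y x z = -associator x y z := by
  have := h.left_lin x y z
  simp only [associator]
  rw [← sub_eq_zero] at this ⊢
  rw [← this]; abel

theorem associator_swap_right (x y z : U) : associator x z y = -associator x y z := by
  have := h.right_lin y z x
  simp only [associator]
  rw [← sub_eq_zero] at this ⊢
  rw [← this]; abel

theorem associator_rotate (x y z : U) : associator y z x = associator x y z := by
  rw [h.associator_swap_right y x z, h.associator_swap_left x y z, neg_neg]

theorem flexible (x y : U) : (x * y) * x = x * (y * x) := by
  have h1 := h.associator_swap_right x x y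
  have h2 : associator x x y = 0 := by rw [associator, (h x y).1, sub_self]
  rw [h2, neg_zero, associator, sub_eq_zero] at h1
  exact h1

theorem moufang_left (x y z : U) : ((x * y) * x) * z = x * (y * (x * z)) := by
  have a1 := h.associator_swap_left x (x * y) z
  have a2 := h.associator_swap_right x (x * z) y
  have a3 := h.right_lin y z (x * x)
  have a4 := congrArg (x * ·) (h.right_lin y z x)
  simp only [mul_add, ← (h x _).1, associator] at a1 a2 a3 a4 ⊢
  linear_combination (norm := abel) a1 + a2 - a3 + a4

theorem moufang_right (x y z : U) : z * (x * (y * x)) = ((z * x) * y) * x := by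
  have a1 := h.associator_swap_right z (y * x) x
  have a2 := h.associator_swap_left (z * x) y x
  have a3 := h.left_lin y z (x * x)
  have a4 := congrArg (· * x) (h.left_lin y z x)
  simp only [add_mul, ← (h x _).2, associator] at a1 a2 a3 a4 ⊢
  linear_combination (norm := abel) a3 - a1 - a2 - a4

theorem moufang_middle (x y z : U) : (x * y) * (z * x) = (x * (y * z)) * x := by
  have a1 := h.associator_swap_right x (z * x) y
  have a2 := h.moufang_left x z y
  have a3 := congrArg (x * ·) (h.associator_rotate x y z)
  have a5 := congrArg (x * ·) (h.associator_rotate z x y)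
  have a4 := h.flexible x (y * z)
  have a6 := congrArg (· * y) (h.flexible x z)
  simp only [mul_sub, associator] at a1 a2 a3 a4 a5 a6 ⊢
  linear_combination (norm := abel) a1 - a2 - a3 - a4 - a5 + a6

end Identities
end IsAlternative

section Powers

open LinearMap

variable (F : Type*) [Field F] {U : Type*} [NonUnitalNonAssocRing U]
  [Module F U] [SMulCommClass F U U] [IsScalarTower F U U]

theorem lpow_eq_mulLeft_pow (x : U) (n : ℕ) : lpow x n = (mulLeft F x ^ n) x := by
  induction n with
  | zero => rfl
  | succ n ih => rw [lpow, ih, pow_succ', Module.End.mul_apply, mulLeft_apply]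

namespace IsAlternative

variable {F} (h : IsAlternative U)
include h

theorem mulLeft_lpow (x : U) (n : ℕ) : mulLeft F (lpow x n) = mulLeft F x ^ (n + 1) := by
  induction n using Nat.strong_induction_on with
  | _ n ih =>
    match n with
    | 0 => simp [lpow]
    | 1 => ext z; simp [lpow, pow_succ, (h x z).1]
    | n + 2 =>
      have h1 : lpow x n * x = x * lpow x n := by
        have := congrArg (· x) (ih n (by omega))
        simp only [mulLeft_apply] at this
        rw [this, pow_succ', Module.End.mul_apply, ← lpow_eq_mulLeft_pow, mulLeft_apply]
      have h2 := ih n (by omega)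
      ext z
      rw [mulLeft_apply, lpow, lpow, ← h1, ← h.flexible, h.moufang_left, ← mulLeft_apply F (lpow x n),
        h2, pow_succ (mulLeft F x) (n + 2), pow_succ' (mulLeft F x) (n + 1)]
      simp

theorem lpow_succ' (x : U) (n : ℕ) : lpow x n * x = x * lpow x n := by
  -- the scalars play no role
  have key : ∀ m, ∀ z, lpow x m * z = (fun y => x * y)^[m + 1] z := by
    intro m
    induction m using Nat.strong_induction_on with
    | _ m ih =>
      match m with
      | 0 => intro z; rfl
      | 1 => intro z; simp [lpow, (h x z).1]
      | m + 2 =>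
        intro z
        have hit : ∀ k, (fun y => x * y)^[k] x = lpow x k := by
          intro k
          induction k with
          | zero => rfl
          | succ k ihk => rw [Function.iterate_succ_apply', ihk, lpow]
        have h1 : lpow x m * x = x * lpow x m := by
          rw [ih m (by omega), Function.iterate_succ_apply', hit]
        rw [lpow, lpow, ← h1, ← h.flexible, h.moufang_left, ih m (by omega),
          Function.iterate_succ_apply', Function.iterate_succ_apply, Function.iterate_succ_apply',
          Function.iterate_succ_apply']
  rw [key, Function.iterate_succ_apply']
  congr 1
  clear key
  induction n with
  | zero => rfl
  | succ k ihk => rw [Function.iterate_succ_apply', ihk, lpow]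

theorem mulRight_lpow (x : U) (n : ℕ) : mulRight F (lpow x n) = mulRight F x ^ (n + 1) := by
  induction n using Nat.strong_induction_on with
  | _ n ih =>
    match n with
    | 0 => simp [lpow]
    | 1 => ext z; simp [lpow, pow_succ, (h x z).2]
    | n + 2 =>
      have h2 := ih n (by omega)
      ext z
      rw [mulRight_apply, lpow, lpow, ← h.lpow_succ', h.moufang_right,
        ← mulRight_apply F (lpow x n), h2, pow_succ (mulRight F x) (n + 2),
        pow_succ' (mulRight F x) (n + 1)]
      simp

theorem isNilpotent_mulLeft {x : U} (hx : IsNilElem x) : IsNilpotent (mulLeft F x) := by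
  obtain ⟨n, hn⟩ := hx
  exact ⟨n + 1, by rw [← h.mulLeft_lpow, hn]; ext; simp⟩

theorem isNilpotent_mulRight {x : U} (hx : IsNilElem x) : IsNilpotent (mulRight F x) := by
  obtain ⟨n, hn⟩ := hx
  exact ⟨n + 1, by rw [← h.mulRight_lpow, hn]; ext; simp⟩

omit h in
theorem isNilElem_of_mulLeft {x : U} (hx : IsNilpotent (mulLeft F x)) : IsNilElem x := by
  obtain ⟨n, hn⟩ := hx
  exact ⟨n, by rw [lpow_eq_mulLeft_pow F, hn]; simp⟩

end IsAlternative

end Powers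

section Evaluation

open LinearMap Polynomial

variable {F : Type*} [Field F] {C : Type*} [NonAssocRing C]
  [Module F C] [SMulCommClass F C C] [IsScalarTower F C C]

/-- Evaluation of a polynomial at an element of a unital alternative algebra. -/
noncomputable def altEval (x : C) : F[X] →ₗ[F] C :=
  (LinearMap.applyₗ (1 : C)) ∘ₗ (aeval (mulLeft F x)).toLinearMap

theorem altEval_apply (x : C) (p : F[X]) : altEval x p = aeval (mulLeft F x) p 1 := rfl

theorem altEval_X_pow_succ (x : C) (n : ℕ) : altEval (F := F) x (X ^ (n + 1)) = lpow x n := by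
  rw [altEval_apply, map_pow, aeval_X, pow_succ, Module.End.mul_apply, mulLeft_apply, mul_one,
    lpow_eq_mulLeft_pow F]

namespace IsAlternative

variable (h : IsAlternative C)
include h

theorem mulLeft_altEval (x : C) (p : F[X]) :
    mulLeft F (altEval x p) = aeval (mulLeft F x) p := by
  induction p using Polynomial.induction_on' with
  | add p q hp hq =>
    rw [map_add, map_add, ← hp, ← hq]; ext; simp [add_mul]
  | monomial n a =>
    rw [← smul_X_eq_monomial, map_smul, map_smul]
    have : mulLeft F (altEval (F := F) x (X ^ n)) = aeval (mulLeft F x) (X ^ n : F[X]) := by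
      cases n with
      | zero => ext; simp [altEval_apply]
      | succ n => rw [altEval_X_pow_succ, h.mulLeft_lpow, map_pow, aeval_X]
    rw [← this]; ext; simp [smul_mul_assoc]

theorem mulRight_altEval (x : C) (p : F[X]) :
    mulRight F (altEval x p) = aeval (mulRight F x) p := by
  induction p using Polynomial.induction_on' with
  | add p q hp hq =>
    rw [map_add, map_add, ← hp, ← hq]; ext; simp [mul_add]
  | monomial n a =>
    rw [← smul_X_eq_monomial, map_smul, map_smul]
    have : mulRight F (altEval (F := F) x (X ^ n)) = aeval (mulRight F x) (X ^ n : F[X]) := by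
      cases n with
      | zero => ext; simp [altEval_apply]
      | succ n => rw [altEval_X_pow_succ, h.mulRight_lpow, map_pow, aeval_X]
    rw [← this]; ext; simp [mul_smul_comm]

theorem altEval_mul (x : C) (p q : F[X]) : altEval x (p * q) = altEval x p * altEval x q := by
  rw [altEval_apply, map_mul, Module.End.mul_apply, ← h.mulLeft_altEval x p, ← altEval_apply,
    mulLeft_apply]

theorem exists_idempotent [FiniteDimensional F C] {x : C} (hx : ¬ IsNilElem x) :
    ∃ q : F[X], altEval x (X * q) ≠ 0 ∧
      altEval x (X * q) * altEval x (X * q) = altEval x (X * q) := by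
  set T := mulLeft F x
  have hint : IsIntegral F T := Algebra.IsIntegral.isIntegral T
  have hm0 : minpoly F T ≠ 0 := minpoly.ne_zero hint
  obtain ⟨g, hg, hndvd⟩ := (minpoly F T).exists_eq_pow_rootMultiplicity_mul_and_not_dvd hm0 0
  set k := (minpoly F T).rootMultiplicity 0
  rw [C_0, sub_zero] at hg hndvd
  have hcop : IsCoprime (X ^ (k + 1)) g :=
    IsCoprime.pow_left ((irreducible_X.coprime_iff_not_dvd).2 hndvd)
  obtain ⟨a, b, hab⟩ := hcop
  have hzero : altEval (F := F) x (X ^ k * g) = 0 := by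
    rw [altEval_apply, ← hg, minpoly.aeval]; rfl
  refine ⟨a * X ^ k, ?_, ?_⟩
  · intro h0
    apply hx
    refine ⟨k, ?_⟩
    rw [← altEval_X_pow_succ (F := F)]
    have e : (X ^ (k + 1) : F[X]) = X ^ (k + 1) * (X * (a * X ^ k)) + X * b * (X ^ k * g) := by
      linear_combination -(X ^ (k + 1)) * hab
    rw [e, map_add, h.altEval_mul x (X ^ (k + 1)) (X * (a * X ^ k)),
      h.altEval_mul x (X * b) (X ^ k * g), h0, hzero, mul_zero, mul_zero, add_zero]
  · rw [← h.altEval_mul]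
    have e : X * (a * X ^ k) * (X * (a * X ^ k)) =
        X * (a * X ^ k) - (a * b * X) * (X ^ k * g) := by
      linear_combination (a * X ^ (k + 1)) * hab
    rw [e, map_sub, h.altEval_mul x (a * b * X), hzero, mul_zero, sub_zero]

end IsAlternative

end Evaluation

/-- `y` has a two-sided inverse which cancels in all products. -/
def HasStrongInverse {C : Type*} [NonAssocRing C] (y : C) : Prop :=
  ∃ w : C, ∀ z : C, w * (y * z) = z ∧ y * (w * z) = z ∧ (z * y) * w = z ∧ (z * w) * y = z

theorem not_hasStrongInverse_of_isNilElem {C : Type*} [NonAssocRing C] [Nontrivial C] {x : C} (hx : IsNilElem x) :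
    ¬ HasStrongInverse x := by
  rintro ⟨w, hw⟩
  obtain ⟨n, hn⟩ := hx
  induction n with
  | zero =>
    have := (hw 1).1
    rw [show x = 0 from hn] at this
    simp at this
  | succ n ih =>
    apply ih
    rw [← (hw (lpow x n)).1]
    rw [lpow] at hn
    rw [hn, mul_zero]

theorem HasStrongInverse.inverse {C : Type*} [NonAssocRing C] {y : C} (hy : HasStrongInverse y) :
    ∃ w : C, HasStrongInverse w ∧
      ∀ z : C, w * (y * z) = z ∧ y * (w * z) = z ∧ (z * y) * w = z ∧ (z * w) * y = z := by
  obtain ⟨w, hw⟩ := hy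
  exact ⟨w, ⟨y, fun z => ⟨(hw z).2.1, (hw z).1, (hw z).2.2.2, (hw z).2.2.1⟩⟩, hw⟩

section LocalAlgebra

open LinearMap Polynomial

variable {F : Type*} [Field F] {C : Type*} [NonAssocRing C]
  [Module F C] [SMulCommClass F C C] [IsScalarTower F C C] [FiniteDimensional F C]

namespace IsAlternative

variable (h : IsAlternative C)
include h

variable (F) in
include F in
theorem hasStrongInverse_of_not_isNilElem (hid : ∀ f : C, f * f = f → f = 0 ∨ f = 1) {x : C}
    (hx : ¬ IsNilElem x) : HasStrongInverse x := by
  obtain ⟨q, hq0, hq⟩ := h.exists_idempotent (F := F) hx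
  have h1 : altEval x (X * q) = 1 := (hid _ hq).resolve_left hq0
  have hL := h.mulLeft_altEval x (X * q)
  have hR := h.mulRight_altEval x (X * q)
  have hL' : aeval (mulLeft F x) (q * X) = mulLeft F 1 := by rw [mul_comm, ← hL, h1]
  have hR' : aeval (mulRight F x) (q * X) = mulRight F 1 := by rw [mul_comm, ← hR, h1]
  rw [h1] at hL hR
  rw [map_mul, aeval_X] at hL hR hL' hR'
  rw [← h.mulLeft_altEval] at hL hL'
  rw [← h.mulRight_altEval] at hR hR'
  refine ⟨altEval x q, fun z => ⟨?_, ?_, ?_, ?_⟩⟩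
  · simpa using congrArg (· z) hL'
  · simpa using (congrArg (· z) hL).symm
  · simpa using congrArg (· z) hR'
  · simpa using (congrArg (· z) hR).symm

section Local

variable [Nontrivial C] (hid : ∀ f : C, f * f = f → f = 0 ∨ f = 1)
include hid

variable (F) in
include F in
theorem not_isNilElem_mul {u c : C} (hu : ¬ IsNilElem u) (hc : ¬ IsNilElem c) :
    ¬ IsNilElem (u * c) := by
  intro hn
  obtain ⟨v, hv⟩ := h.hasStrongInverse_of_not_isNilElem F hid hu
  obtain ⟨d, hd⟩ := h.hasStrongInverse_of_not_isNilElem F hid hc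
  have key : ∀ x, (u * c) * x = 0 → x = 0 := by
    intro x hx
    have h1 := h.moufang_middle u c (x * v)
    rw [(hv x).2.2.2, hx] at h1
    have h2 : u * (c * (x * v)) = 0 := by
      rw [← (hv (u * (c * (x * v)))).2.2.1, ← h1, zero_mul]
    have h3 : c * (x * v) = 0 := by rw [← (hv (c * (x * v))).1, h2, mul_zero]
    have h4 : x * v = 0 := by rw [← (hd (x * v)).1, h3, mul_zero]
    rw [← (hv x).2.2.2, h4, zero_mul]
  obtain ⟨n, hn⟩ := hn
  induction n with
  | zero =>
    have := key 1 (by rw [mul_one]; exact hn)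
    exact one_ne_zero this
  | succ n ih => exact ih (key _ hn)

variable (F) in
include F in
theorem isNilElem_mul_right {x y : C} (hx : IsNilElem x) (hy : ¬ IsNilElem y) :
    IsNilElem (x * y) := by
  by_contra hxy
  obtain ⟨w, hw, hw'⟩ := (h.hasStrongInverse_of_not_isNilElem F hid hy).inverse
  have hwn : ¬ IsNilElem w := fun hn => not_hasStrongInverse_of_isNilElem hn hw
  have := h.not_isNilElem_mul F hid hxy hwn
  rw [(hw' x).2.2.1] at this
  exact this hx

variable (F) in
include F in
theorem isNilElem_mul_left {x y : C} (hx : IsNilElem x) (hy : ¬ IsNilElem y) :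
    IsNilElem (y * x) := by
  by_contra hxy
  obtain ⟨w, hw, hw'⟩ := (h.hasStrongInverse_of_not_isNilElem F hid hy).inverse
  have hwn : ¬ IsNilElem w := fun hn => not_hasStrongInverse_of_isNilElem hn hw
  have := h.not_isNilElem_mul F hid hwn hxy
  rw [(hw' x).1] at this
  exact this hx

variable (F) in
include F in
theorem not_isNilElem_one_sub {x : C} (hx : IsNilElem x) : ¬ IsNilElem (1 - x) := by
  intro h1
  have e1 := h.isNilpotent_mulLeft (F := F) hx
  have e2 := h.isNilpotent_mulLeft (F := F) h1
  have e3 : mulLeft F (1 - x) = 1 - mulLeft F x := by ext z; simp [sub_mul]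
  rw [e3] at e2
  exact e2.not_isUnit e1.isUnit_one_sub

variable (F) in
include F in
theorem isNilElem_add {x y : C} (hx : IsNilElem x) (hy : IsNilElem y) : IsNilElem (x + y) := by
  by_contra hxy
  obtain ⟨w, hw, hw'⟩ := (h.hasStrongInverse_of_not_isNilElem F hid hxy).inverse
  have hwn : ¬ IsNilElem w := fun hn => not_hasStrongInverse_of_isNilElem hn hw
  have e1 := h.isNilElem_mul_left F hid hx hwn
  have e2 := h.isNilElem_mul_left F hid hy hwn
  have e3 := (hw' 1).1
  rw [mul_one, mul_add] at e3
  exact h.not_isNilElem_one_sub F hid e1 (by rw [← e3, add_sub_cancel_left]; exact e2)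

omit hid [Nontrivial C] [FiniteDimensional F C] h in
theorem _root_.IsNilElem.smul {x : C} (hx : IsNilElem x) (c : F) : IsNilElem (c • x) := by
  obtain ⟨n, hn⟩ := hx
  have : ∀ m, lpow (c • x) m = c ^ (m + 1) • lpow x m := by
    intro m
    induction m with
    | zero => simp [lpow]
    | succ m ih => rw [lpow, ih, lpow, smul_mul_smul_comm]; ring_nf
  exact ⟨n, by rw [this, hn, smul_zero]⟩

variable (F) in
include F in
theorem isNilElem_mul {x : C} (hx : IsNilElem x) (y : C) : IsNilElem (x * y) := by
  by_cases hy : IsNilElem y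
  · have h1 := h.isNilElem_mul_right F hid hx (h.not_isNilElem_one_sub F hid hy)
    have h2 := h.isNilElem_add F hid hx (h1.smul (-1 : F))
    simpa [mul_sub] using h2
  · exact h.isNilElem_mul_right F hid hx hy

theorem exists_isNilElem_sub [IsAlgClosed F] (x : C) : ∃ c : F, IsNilElem (x - c • (1 : C)) := by
  obtain ⟨c, hc⟩ := Module.End.exists_eigenvalue (mulLeft F x)
  obtain ⟨v, hv⟩ := hc.exists_hasEigenvector
  refine ⟨c, ?_⟩
  by_contra hn
  obtain ⟨w, hw⟩ := h.hasStrongInverse_of_not_isNilElem F hid hn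
  apply hv.2
  rw [← (hw v).1]
  have : (x - c • (1 : C)) * v = 0 := by
    have := hv.apply_eq_smul
    rw [mulLeft_apply] at this
    rw [sub_mul, this, smul_mul_assoc, one_mul, sub_self]
  rw [this, mul_zero]

/-- A finite-dimensional unital alternative algebra without nontrivial idempotents has a
multiplicative functional whose kernel consists of the nil elements. -/
theorem exists_local_functional [IsAlgClosed F] :
    ∃ l : C →ₗ[F] F, (∀ x y, l (x * y) = l x * l y) ∧ l 1 = 1 ∧ ∀ x, IsNilElem x ↔ l x = 0 := by
  choose l hl using h.exists_isNilElem_sub (F := F) hid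
  have huniq : ∀ x (c : F), IsNilElem (x - c • (1 : C)) → l x = c := by
    intro x c hc
    by_contra hne
    have h1 := h.isNilElem_add F hid (hl x) (hc.smul (-1 : F))
    have e : x - l x • (1 : C) + (-1 : F) • (x - c • (1 : C)) = (c - l x) • (1 : C) := by
      rw [sub_smul, neg_one_smul]; abel
    rw [e] at h1
    have h2 := h1.smul ((c - l x)⁻¹)
    rw [smul_smul, inv_mul_cancel₀ (sub_ne_zero.2 (Ne.symm hne)), one_smul] at h2
    apply h.not_isNilElem_one_sub F hid h2
    rw [sub_self]; exact ⟨0, rfl⟩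
  refine ⟨{ toFun := l, map_add' := fun x y => huniq _ _ ?_, map_smul' := fun c x => huniq _ _ ?_ },
    fun x y => huniq _ _ ?_, huniq _ _ ?_, fun x => ⟨fun hx => huniq _ _ ?_, fun hx => ?_⟩⟩
  · have := h.isNilElem_add F hid (hl x) (hl y)
    convert this using 1
    rw [add_smul]; abel
  · have := (hl x).smul c
    convert this using 1
    rw [smul_sub, smul_smul]; rfl
  · have h1 := h.isNilElem_mul F hid (hl x) (y - l y • (1 : C))
    have h2 := h.isNilElem_add F hid (h.isNilElem_add F hid h1 ((hl x).smul (l y)))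
      ((hl y).smul (l x))
    convert h2 using 1
    simp only [sub_mul, mul_sub, smul_sub, smul_mul_assoc, mul_smul_comm, one_mul, mul_one,
      smul_smul, coe_mk, AddHom.coe_mk]
    rw [mul_comm (l y) (l x)]; abel
  · rw [one_smul, sub_self]; exact ⟨0, rfl⟩
  · rw [zero_smul, sub_zero]; exact hx
  · have := hl x
    rw [show l x = 0 from hx, zero_smul, sub_zero] at this
    exact this

end Local

end IsAlternative

end LocalAlgebra

section Peirce

/-- The elements on which `e` acts as identity from the left and `f` from the right. -/
def peirceSpace (F : Type*) [Field F] {U : Type*} [NonAssocRing U] [Module F U]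
    [SMulCommClass F U U] [IsScalarTower F U U] (e f : U) : Submodule F U where
  carrier := {x | e * x = x ∧ x * f = x}
  add_mem' := by
    rintro x y ⟨h1, h2⟩ ⟨h3, h4⟩
    exact ⟨by rw [mul_add, h1, h3], by rw [add_mul, h2, h4]⟩
  zero_mem' := ⟨mul_zero _, zero_mul _⟩
  smul_mem' := by
    rintro c x ⟨h1, h2⟩
    exact ⟨by rw [mul_smul_comm, h1], by rw [smul_mul_assoc, h2]⟩

variable {F : Type*} [Field F] {U : Type*} [NonAssocRing U] [Module F U]
  [SMulCommClass F U U] [IsScalarTower F U U]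

theorem mem_peirceSpace {e f x : U} : x ∈ peirceSpace F e f ↔ e * x = x ∧ x * f = x := Iff.rfl

theorem eq_zero_of_add_self (F : Type*) [Field F] {M : Type*} [AddCommGroup M] [Module F M]
    (h2 : (2 : F) ≠ 0) {x : M} (hx : x + x = 0) : x = 0 := by
  rw [← two_smul F] at hx
  exact (smul_eq_zero.1 hx).resolve_left h2

theorem eq_zero_of_eq_neg (F : Type*) [Field F] {M : Type*} [AddCommGroup M] [Module F M]
    (h2 : (2 : F) ≠ 0) {x : M} (hx : x = -x) : x = 0 :=
  eq_zero_of_add_self F h2 (by nth_rw 2 [hx]; exact add_neg_cancel x)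

namespace IsAlternative

variable (h : IsAlternative U)
include h

theorem idem_mul_idem_mul {e : U} (he : e * e = e) (x : U) : e * (e * x) = e * x := by
  rw [← (h e x).1, he]

theorem mul_idem_mul_idem {e : U} (he : e * e = e) (x : U) : (x * e) * e = x * e := by
  rw [(h e x).2, he]

theorem orth_mul_mul (h2 : (2 : F) ≠ 0) {e f : U} (he : e * e = e) (hef : e * f = 0)
    (hfe : f * e = 0) (x : U) : e * (f * x) = 0 := by
  have key : ∀ z, e * (f * z) = -(f * (e * z)) := by
    intro z
    have := h.left_lin e f z
    rw [hef, hfe, zero_mul, add_zero] at this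
    exact eq_neg_of_add_eq_zero_left this.symm
  apply eq_zero_of_eq_neg F h2
  have h1 : e * (f * x) = f * (e * x) := by
    calc e * (f * x) = e * (e * (f * x)) := (h.idem_mul_idem_mul he _).symm
      _ = -(e * (f * (e * x))) := by rw [key x, mul_neg]
      _ = f * (e * (e * x)) := by rw [key, neg_neg]
      _ = f * (e * x) := by rw [h.idem_mul_idem_mul he]
  nth_rw 1 [h1]
  rw [key, neg_neg]

theorem mul_orth_mul (h2 : (2 : F) ≠ 0) {e f : U} (he : e * e = e) (hef : e * f = 0)
    (hfe : f * e = 0) (x : U) : (x * f) * e = 0 := by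
  have key : ∀ z, (z * f) * e = -((z * e) * f) := by
    intro z
    have := h.right_lin e f z
    rw [hef, hfe, mul_zero, add_zero] at this
    exact eq_neg_of_add_eq_zero_right this
  apply eq_zero_of_eq_neg F h2
  have h1 : (x * f) * e = (x * e) * f := by
    calc (x * f) * e = ((x * f) * e) * e := (h.mul_idem_mul_idem he _).symm
      _ = -(((x * e) * f) * e) := by rw [key x, neg_mul]
      _ = ((x * e) * e) * f := by rw [key, neg_neg]
      _ = (x * e) * f := by rw [h.mul_idem_mul_idem he]
  nth_rw 1 [h1]
  rw [key, neg_neg]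

theorem mul_mem_corner {e x y : U} (hx : x ∈ peirceSpace F e e) (hy : y ∈ peirceSpace F e e) :
    x * y ∈ peirceSpace F e e := by
  rw [mem_peirceSpace] at *
  constructor
  · have := h.associator_swap_left x e y
    simp only [associator, hx.1, hx.2, hy.1, hy.2] at this
    rw [sub_self, neg_zero, sub_eq_zero] at this
    exact this.symm
  · have := h.associator_swap_right x e y
    simp only [associator, hx.1, hx.2, hy.1, hy.2] at this
    rw [sub_self, neg_zero, sub_eq_zero] at this
    exact this

theorem corner_proj_mem {e : U} (he : e * e = e) (x : U) : (e * x) * e ∈ peirceSpace F e e := by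
  rw [mem_peirceSpace]
  constructor
  · rw [← h.flexible, h.idem_mul_idem_mul he]
  · exact h.mul_idem_mul_idem he _

end IsAlternative

/-- A functional on `U` which is supported on the corner of the idempotent `e` and which exhibits
this corner as a local algebra with residue field `F`. -/
structure CornerFunctional (F : Type*) [Field F] {U : Type*} [NonAssocRing U] [Module F U]
    [SMulCommClass F U U] [IsScalarTower F U U] (e : U) (l : U →ₗ[F] F) : Prop where
  map_idem : l e = 1
  map_mul : ∀ x ∈ peirceSpace F e e, ∀ y ∈ peirceSpace F e e, l (x * y) = l x * l y
  isNilElem_iff : ∀ x ∈ peirceSpace F e e, IsNilElem x ↔ l x = 0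
  map_corner : ∀ x, l ((e * x) * e) = l x
  exists_inv : ∀ x ∈ peirceSpace F e e, l x ≠ 0 → ∃ c ∈ peirceSpace F e e, x * c = e ∧ c * x = e

theorem IsAlternative.exists_cornerFunctional [IsAlgClosed F] [FiniteDimensional F U]
    (h : IsAlternative U) {e : U} (he : e * e = e) (he0 : e ≠ 0)
    (hprim : ∀ f : U, f * f = f → f ∈ peirceSpace F e e → f = 0 ∨ f = e) :
    ∃ l : U →ₗ[F] F, CornerFunctional F e l := by
  let C : NonUnitalSubalgebra F U :=
    { peirceSpace F e e with mul_mem' := fun hx hy => h.mul_mem_corner hx hy }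
  have hC : ∀ x, x ∈ C ↔ x ∈ peirceSpace F e e := fun x => Iff.rfl
  letI instR : NonAssocRing C :=
    { (inferInstance : NonUnitalNonAssocRing C) with
      one := ⟨e, he, he⟩
      one_mul := fun x => Subtype.ext x.2.1
      mul_one := fun x => Subtype.ext x.2.2 }
  have hmul : ∀ x y : C, ((x * y : C) : U) = x * y := fun _ _ => rfl
  have hone : ((1 : C) : U) = e := rfl
  haveI : FiniteDimensional F C := inferInstanceAs (FiniteDimensional F (peirceSpace F e e))
  haveI : Nontrivial C := ⟨⟨0, 1, fun h0 => he0 (congrArg Subtype.val h0).symm⟩⟩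
  haveI : SMulCommClass F C C := ⟨fun c x y => Subtype.ext (mul_smul_comm c (x : U) (y : U)).symm⟩
  haveI : IsScalarTower F C C := ⟨fun c x y => Subtype.ext (smul_mul_assoc c (x : U) (y : U))⟩
  have hCalt : IsAlternative C := fun x y => ⟨Subtype.ext (h x y).1, Subtype.ext (h x y).2⟩
  have hid : ∀ f : C, f * f = f → f = 0 ∨ f = 1 := by
    intro f hf
    rcases hprim f (congrArg Subtype.val hf) f.2 with h0 | h1
    · exact Or.inl (Subtype.ext h0)
    · exact Or.inr (Subtype.ext h1)
  have hpow : ∀ (x : C) n, ((lpow x n : C) : U) = lpow (x : U) n := by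
    intro x n
    induction n with
    | zero => rfl
    | succ n ih => rw [lpow, hmul, ih, lpow]
  have hnil : ∀ x : C, IsNilElem x ↔ IsNilElem (x : U) := by
    intro x
    refine exists_congr fun n => ?_
    rw [← hpow]
    exact ⟨fun h0 => by rw [h0]; rfl, fun h0 => Subtype.ext h0⟩
  obtain ⟨l, hl, hl1, hlnil⟩ := hCalt.exists_local_functional (F := F) hid
  let p : U →ₗ[F] C :=
    { toFun := fun x => ⟨(e * x) * e, h.corner_proj_mem (F := F) he x⟩
      map_add' := fun x y => Subtype.ext (by
        show e * (x + y) * e = e * x * e + e * y * e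
        rw [mul_add, add_mul])
      map_smul' := fun c x => Subtype.ext (by
        show e * (c • x) * e = c • (e * x * e)
        rw [mul_smul_comm, smul_mul_assoc]) }
  have hp : ∀ x (hx : x ∈ peirceSpace F e e), p x = (⟨x, hx⟩ : C) := by
    intro x hx
    apply Subtype.ext
    show e * x * e = x
    rw [hx.1, hx.2]
  refine ⟨l ∘ₗ p, ?_, ?_, ?_, ?_, ?_⟩
  · rw [LinearMap.comp_apply, hp e ⟨he, he⟩]; exact hl1
  · intro x hx y hy
    rw [LinearMap.comp_apply, LinearMap.comp_apply, LinearMap.comp_apply, hp x hx, hp y hy,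
      hp _ (h.mul_mem_corner hx hy), ← hl]
    rfl
  · intro x hx
    rw [LinearMap.comp_apply, hp x hx, ← hlnil, hnil]
  · intro x
    rw [LinearMap.comp_apply, LinearMap.comp_apply, hp _ (h.corner_proj_mem he x)]
    rfl
  · intro x hx hlx
    rw [LinearMap.comp_apply, hp x hx, ne_eq, ← hlnil] at hlx
    obtain ⟨w, hw⟩ := hCalt.hasStrongInverse_of_not_isNilElem F hid hlx
    have h1 := (hw 1).2.1
    have h3 := (hw 1).1
    rw [mul_one] at h1 h3
    exact ⟨w, (hC (w : U)).1 w.2, congrArg Subtype.val h1, congrArg Subtype.val h3⟩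

/-- A finite family of orthogonal idempotents with sum `1` in an alternative algebra over a field
of characteristic different from `2`. -/
structure PeirceFamily (F : Type*) [Field F] (U : Type*) [NonAssocRing U] [Module F U]
    [SMulCommClass F U U] [IsScalarTower F U U] (ι : Type*) [Fintype ι] where
  /-- The idempotents. -/
  e : ι → U
  mul_self : ∀ i, e i * e i = e i
  orth : ∀ i j, i ≠ j → e i * e j = 0
  sum_one : ∑ i, e i = 1
  alt : IsAlternative U
  two_ne_zero : (2 : F) ≠ 0

namespace PeirceFamily

variable {ι : Type*} [Fintype ι]

variable (E : PeirceFamily F U ι)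

/-- The Peirce components of a Peirce family. -/
def P (i j : ι) : Submodule F U := peirceSpace F (E.e i) (E.e j)

theorem e_mem (i : ι) : E.e i ∈ E.P i i := ⟨E.mul_self i, E.mul_self i⟩

theorem e_mul [DecidableEq ι] {i j : ι} {x : U} (hx : x ∈ E.P i j) (a : ι) :
    E.e a * x = if a = i then x else 0 := by
  split_ifs with hai
  · rw [hai]; exact hx.1
  · rw [← hx.1]
    exact E.alt.orth_mul_mul E.two_ne_zero (E.mul_self a) (E.orth _ _ hai) (E.orth _ _ (Ne.symm hai)) x

theorem mul_e [DecidableEq ι] {i j : ι} {x : U} (hx : x ∈ E.P i j) (a : ι) :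
    x * E.e a = if a = j then x else 0 := by
  split_ifs with hai
  · rw [hai]; exact hx.2
  · rw [← hx.2]
    exact E.alt.mul_orth_mul E.two_ne_zero (E.mul_self a) (E.orth _ _ hai) (E.orth _ _ (Ne.symm hai)) x

theorem e_mul_mul_e (i j : ι) (x : U) : (E.e i * x) * E.e j = E.e i * (x * E.e j) := by
  by_cases hij : i = j
  · subst hij; exact E.alt.flexible _ _
  · have := E.alt.associator_swap_right (E.e i) (E.e j) x
    rw [associator, associator, E.orth i j hij, zero_mul,
      E.alt.orth_mul_mul E.two_ne_zero (E.mul_self i) (E.orth _ _ hij) (E.orth _ _ (Ne.symm hij)), sub_zero,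
      neg_zero, sub_eq_zero] at this
    exact this

theorem proj_mem (i j : ι) (x : U) : (E.e i * x) * E.e j ∈ E.P i j := by
  refine ⟨?_, E.alt.mul_idem_mul_idem (E.mul_self j) _⟩
  rw [← E.e_mul_mul_e, E.alt.idem_mul_idem_mul (E.mul_self i)]

theorem sum_proj (x : U) : ∑ i, ∑ j, (E.e i * x) * E.e j = x := by
  simp_rw [← Finset.mul_sum, E.sum_one, mul_one, ← Finset.sum_mul, E.sum_one, one_mul]

theorem induction {p : U → Prop} (h0 : p 0) (hadd : ∀ x y, p x → p y → p (x + y))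
    (hP : ∀ i j, ∀ x ∈ E.P i j, p x) (x : U) : p x := by
  rw [← E.sum_proj x]
  refine Finset.sum_induction _ p hadd h0 fun i _ => ?_
  exact Finset.sum_induction _ p hadd h0 fun j _ => hP i j _ (E.proj_mem i j x)

variable [DecidableEq ι]

theorem e_mul_prod {i j k l : ι} {x y : U} (hx : x ∈ E.P i j) (hy : y ∈ E.P k l) (a : ι) :
    E.e a * (x * y) =
      (if a = i then x * y else 0) + (if a = j then x * y else 0) -
        (if a = k then x * y else 0) := by
  have := E.alt.associator_swap_left x (E.e a) y
  simp only [associator] at this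
  rw [E.e_mul hx, E.e_mul hy, E.mul_e hx] at this
  simp only [ite_mul, mul_ite, zero_mul, mul_zero] at this
  linear_combination (norm := abel) -this

theorem prod_mul_e {i j k l : ι} {x y : U} (hx : x ∈ E.P i j) (hy : y ∈ E.P k l) (a : ι) :
    (x * y) * E.e a =
      (if a = l then x * y else 0) - (if a = j then x * y else 0) +
        (if a = k then x * y else 0) := by
  have := E.alt.associator_swap_right x (E.e a) y
  simp only [associator] at this
  rw [E.e_mul hy, E.mul_e hy, E.mul_e hx] at this
  simp only [ite_mul, mul_ite, zero_mul, mul_zero] at this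
  linear_combination (norm := abel) this

theorem mul_mem {i j k : ι} {x y : U} (hx : x ∈ E.P i j) (hy : y ∈ E.P j k) :
    x * y ∈ E.P i k := by
  refine ⟨?_, ?_⟩
  · rw [E.e_mul_prod hx hy]; simp
  · rw [E.prod_mul_e hx hy]; simp

theorem mul_mem_swap {i j : ι} (hij : i ≠ j) {x y : U} (hx : x ∈ E.P i j)
    (hy : y ∈ E.P i j) : x * y ∈ E.P j i := by
  refine ⟨?_, ?_⟩
  · rw [E.e_mul_prod hx hy]; simp [hij.symm]
  · rw [E.prod_mul_e hx hy]; simp [hij]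

theorem mul_eq_zero {i j k l : ι} {x y : U} (hx : x ∈ E.P i j) (hy : y ∈ E.P k l)
    (hjk : j ≠ k) (hne : ¬ (i = k ∧ j = l)) : x * y = 0 := by
  by_cases hij : i = j
  · subst hij
    have h1 := E.e_mul_prod hx hy i
    simp only [if_true, if_neg hjk, sub_zero] at h1
    have h3 := E.alt.idem_mul_idem_mul (E.mul_self i) (x * y)
    rw [h1, mul_add, h1] at h3
    exact eq_zero_of_add_self F E.two_ne_zero (add_eq_left.1 h3)
  by_cases hik : i = k
  · subst hik
    have hjl : j ≠ l := fun hh => hne ⟨rfl, hh⟩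
    have h1 := E.prod_mul_e hx hy j
    simp only [if_true, if_neg hjk, if_neg hjl, zero_sub, add_zero] at h1
    have h3 := E.alt.mul_idem_mul_idem (E.mul_self j) (x * y)
    rw [h1, neg_mul, h1, neg_neg] at h3
    exact eq_zero_of_eq_neg F E.two_ne_zero h3
  · have h1 := E.e_mul_prod hx hy i
    have h3 := E.e_mul_prod hx hy j
    simp only [if_true, if_neg hjk, if_neg hij, if_neg (Ne.symm hij), if_neg hik, sub_zero,
      zero_add, add_zero] at h1 h3
    rw [← h1]
    nth_rw 1 [← h3]
    exact E.alt.orth_mul_mul E.two_ne_zero (E.mul_self i) (E.orth _ _ hij) (E.orth _ _ (Ne.symm hij)) _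

theorem eq_zero_of_mem_of_ne {i j k l : ι} {x : U} (hx : x ∈ E.P i j) (hx' : x ∈ E.P k l)
    (hne : ¬ (i = k ∧ j = l)) : x = 0 := by
  by_cases hik : k = i
  · have hjl : l ≠ j := fun hh => hne ⟨hik.symm, hh.symm⟩
    rw [← hx'.2, E.mul_e hx, if_neg hjl]
  · rw [← hx'.1, E.e_mul hx, if_neg hik]

theorem mul_self_eq_zero {i j : ι} (hij : i ≠ j) {x : U} (hx : x ∈ E.P i j) : x * x = 0 := by
  have h1 := (E.alt x (E.e j)).2
  have h3 := (E.mul_mem_swap hij hx hx)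
  have h4 := E.e_mul hx j
  rw [if_neg (Ne.symm hij)] at h4
  rw [h4, zero_mul] at h1
  rw [← h3.1, ← h1]

theorem mul_anticomm {i j : ι} (hij : i ≠ j) {x y : U} (hx : x ∈ E.P i j)
    (hy : y ∈ E.P i j) : x * y = -(y * x) := by
  have h1 := E.mul_self_eq_zero hij (add_mem hx hy)
  rw [add_mul, mul_add, mul_add, E.mul_self_eq_zero hij hx,
    E.mul_self_eq_zero hij hy, zero_add, add_zero] at h1
  exact eq_neg_of_add_eq_zero_left h1

/-- Associativity of path products in the Peirce decomposition. -/
theorem mul_assoc_path {i j k l : ι} {x y z : U} (hx : x ∈ E.P i j) (hy : y ∈ E.P j k)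
    (hz : z ∈ E.P k l) (hne : ¬ (i = k ∧ j = l)) : (x * y) * z = x * (y * z) := by
  rw [← sub_eq_zero]
  change associator x y z = 0
  by_cases hli : l = i
  · subst hli
    have m1 : associator x y z ∈ E.P l l := sub_mem
      (E.mul_mem (E.mul_mem hx hy) hz) (E.mul_mem hx (E.mul_mem hy hz))
    by_cases hlj : l = j
    · have m2 : associator z x y ∈ E.P k k := sub_mem
        (E.mul_mem (E.mul_mem hz hx) hy) (E.mul_mem hz (E.mul_mem hx hy))
      rw [← E.alt.associator_rotate] at m2
      exact E.eq_zero_of_mem_of_ne m1 m2 fun hh => hne ⟨hh.1, hlj.symm⟩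
    · have m2 : associator y z x ∈ E.P j j := sub_mem
        (E.mul_mem (E.mul_mem hy hz) hx) (E.mul_mem hy (E.mul_mem hz hx))
      rw [E.alt.associator_rotate] at m2
      exact E.eq_zero_of_mem_of_ne m1 m2 fun hh => hlj hh.1
  · rw [← E.alt.associator_rotate, associator,
      E.mul_eq_zero (E.mul_mem hy hz) hx hli fun hh => hli (hh.2.trans hh.1),
      E.mul_eq_zero hz hx hli fun hh => hne ⟨hh.1.symm, hh.2.symm⟩, mul_zero, sub_zero]

theorem mul_mul_cyclic {i j : ι} (hij : i ≠ j) {x y z : U} (hx : x ∈ E.P i j)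
    (hy : y ∈ E.P i j) (hz : z ∈ E.P i j) : (x * y) * z = (y * z) * x := by
  have hxyz := E.mul_mem (E.mul_mem_swap hij hx hy) hz
  have hyzx := E.mul_mem (E.mul_mem_swap hij hy hz) hx
  have hxyz' := E.mul_mem hx (E.mul_mem_swap hij hy hz)
  have hyzx' := E.mul_mem hy (E.mul_mem_swap hij hz hx)
  have h1 := congrArg (· * E.e j) (E.alt.associator_rotate x y z)
  simp only [associator, sub_mul] at h1
  rw [hxyz.2, hyzx.2, E.mul_e hxyz', E.mul_e hyzx'] at h1
  simpa [Ne.symm hij] using h1.symm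

theorem swap_mul_eq_sub {i j : ι} (hij : i ≠ j) {x z y : U} (hx : x ∈ E.P i j)
    (hz : z ∈ E.P i j) (hy : y ∈ E.P j i) :
    (x * z) * y = x * (y * z) - (x * y) * z := by
  have h1 := E.alt.associator_swap_right x y z
  rw [associator, associator, E.mul_eq_zero hx (E.mul_mem hz hy) (Ne.symm hij)
    (fun hh => hij hh.2.symm), sub_zero] at h1
  rw [h1, neg_sub]

/-- Refine a family by splitting one of its idempotents. -/
def split [DecidableEq ι] (i : ι) (f : U)
    (hff : f * f = f) (hf : f ∈ E.P i i) : PeirceFamily F U (Option ι) where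
  e := fun o => o.elim (E.e i - f) (fun j => if j = i then f else E.e j)
  mul_self := by
    rintro (_ | j)
    · simp [sub_mul, mul_sub, E.mul_self, hff, hf.1, hf.2]
    · by_cases hj : j = i
      · simp [hj, hff]
      · simp [hj, E.mul_self]
  orth := by
    have h3 : ∀ j, j ≠ i → E.e j * f = 0 := fun j hj => by rw [E.e_mul hf, if_neg hj]
    have h4 : ∀ j, j ≠ i → f * E.e j = 0 := fun j hj => by rw [E.mul_e hf, if_neg hj]
    rintro (_ | j) (_ | k) hjk
    · exact absurd rfl hjk
    · by_cases hk : k = i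
      · simp [hk, sub_mul, hff, hf.1]
      · simp [hk, sub_mul, E.orth i k (Ne.symm hk), h4 k hk]
    · by_cases hj : j = i
      · simp [hj, mul_sub, hff, hf.2]
      · simp [hj, mul_sub, E.orth j i hj, h3 j hj]
    · have hjk' : j ≠ k := fun hh => hjk (congrArg some hh)
      by_cases hj : j = i
      · have hk : k ≠ i := fun hh => hjk' (hj.trans hh.symm)
        simp [hj, hk, h4 k hk]
      · by_cases hk : k = i
        · simp [hj, hk, h3 j hj]
        · simp [hj, hk, E.orth j k hjk']
  sum_one := by
    have h5 := Finset.add_sum_erase Finset.univ (fun j => if j = i then f else E.e j)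
      (Finset.mem_univ i)
    have h6 := Finset.add_sum_erase Finset.univ E.e (Finset.mem_univ i)
    have h7 : ∑ x ∈ Finset.univ.erase i, (if x = i then f else E.e x) =
        ∑ x ∈ Finset.univ.erase i, E.e x :=
      Finset.sum_congr rfl fun x hx => if_neg (Finset.ne_of_mem_erase hx)
    rw [h7, if_pos rfl] at h5
    rw [Fintype.sum_option]
    change E.e i - f + ∑ j, (if j = i then f else E.e j) = 1
    rw [← h5, ← add_assoc, sub_add_cancel, h6, E.sum_one]
  alt := E.alt
  two_ne_zero := E.two_ne_zero

/-- Reindex a Peirce family. -/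
def reindex {κ : Type*} [Fintype κ] (s : κ ≃ ι) : PeirceFamily F U κ where
  e := fun k => E.e (s k)
  mul_self := fun _ => E.mul_self _
  orth := fun _ _ hjk => E.orth _ _ fun hh => hjk (s.injective hh)
  sum_one := by rw [← E.sum_one]; exact s.sum_comp E.e
  alt := E.alt
  two_ne_zero := E.two_ne_zero

theorem card_le_finrank [FiniteDimensional F U] (hne : ∀ i, E.e i ≠ 0) :
    Fintype.card ι ≤ Module.finrank F U := by
  classical
  refine LinearIndependent.fintype_card_le_finrank (R := F) (b := E.e) ?_
  rw [Fintype.linearIndependent_iff]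
  intro g hg i
  have h1 := congrArg (fun z => E.e i * z) hg
  simp only [Finset.mul_sum, mul_smul_comm, mul_zero] at h1
  rw [Finset.sum_eq_single i] at h1
  · rw [E.mul_self] at h1
    exact (smul_eq_zero.1 h1).resolve_right (hne i)
  · intro j _ hj
    rw [E.orth i j (Ne.symm hj), smul_zero]
  · exact fun hi => absurd (Finset.mem_univ i) hi

end PeirceFamily

/-- A Peirce family of primitive idempotents over an algebraically closed field, together with
the functionals of the (local) corners. -/
structure Frame (F : Type*) [Field F] (U : Type*) [NonAssocRing U] [Module F U]
    [SMulCommClass F U U] [IsScalarTower F U U] (ι : Type*) [Fintype ι] extends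
    PeirceFamily F U ι where
  /-- The corner functionals. -/
  lam : ι → U →ₗ[F] F
  corner : ∀ i, CornerFunctional F (e i) (lam i)

theorem IsAlternative.exists_frame [IsAlgClosed F] [FiniteDimensional F U] [Nontrivial U]
    (h : IsAlternative U) (h2 : (2 : F) ≠ 0) : ∃ n, Nonempty (Frame F U (Fin n)) := by
  classical
  let s : Set ℕ := {n | ∃ E : PeirceFamily F U (Fin n), ∀ i, E.e i ≠ 0}
  have h1 : 1 ∈ s := by
    refine ⟨⟨fun _ => 1, fun _ => mul_one _, fun i j hij => absurd (Subsingleton.elim i j) hij,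
      by simp, h, h2⟩, fun _ => one_ne_zero⟩
  have hbdd : BddAbove s := by
    refine ⟨Module.finrank F U, ?_⟩
    rintro n ⟨E, hE⟩
    have := E.card_le_finrank hE
    rwa [Fintype.card_fin] at this
  obtain ⟨E, hE⟩ : sSup s ∈ s := Nat.sSup_mem ⟨1, h1⟩ hbdd
  have hprim : ∀ i, ∀ f : U, f * f = f → f ∈ peirceSpace F (E.e i) (E.e i) →
      f = 0 ∨ f = E.e i := by
    intro i f hff hf
    by_contra! hcon
    have hmem : sSup s + 1 ∈ s := by
      refine ⟨(E.split i f hff hf).reindex (finSuccEquiv _), fun k => ?_⟩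
      change (E.split i f hff hf).e _ ≠ 0
      rcases finSuccEquiv _ k with _ | j
      · exact sub_ne_zero.2 (Ne.symm hcon.2)
      · change (if j = i then f else E.e j) ≠ 0
        split_ifs
        · exact hcon.1
        · exact hE j
    have := le_csSup hbdd hmem
    omega
  choose l hl using fun i => h.exists_cornerFunctional (E.mul_self i) (hE i) (hprim i)
  exact ⟨_, ⟨{ E with lam := l, corner := hl }⟩⟩

end Peirce

section TraceForm

open LinearMap

variable {F : Type*} [Field F] {U : Type*} [NonAssocRing U] [Module F U]
  [SMulCommClass F U U] [IsScalarTower F U U] {ι : Type*} [Fintype ι] [DecidableEq ι]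

namespace Frame

variable (Φ : Frame F U ι)

theorem lam_eq_zero {i j a : ι} {x : U} (hx : x ∈ Φ.P i j) (hne : ¬ (i = a ∧ j = a)) :
    Φ.lam a x = 0 := by
  rw [← (Φ.corner a).map_corner, Φ.e_mul hx]
  split_ifs with hai
  · rw [Φ.mul_e hx, if_neg fun hh => hne ⟨hai.symm, hh.symm⟩, map_zero]
  · rw [zero_mul, map_zero]

/-- The trace functional of a frame. -/
def tau : U →ₗ[F] F := ∑ i, Φ.lam i

omit [DecidableEq ι] in
theorem tau_apply (x : U) : Φ.tau x = ∑ i, Φ.lam i x := by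
  rw [tau, LinearMap.sum_apply]

theorem tau_eq_lam {i : ι} {x : U} (hx : x ∈ Φ.P i i) : Φ.tau x = Φ.lam i x := by
  rw [tau_apply, Finset.sum_eq_single i]
  · exact fun j _ hj => Φ.lam_eq_zero hx fun hh => hj hh.1.symm
  · exact fun hi => absurd (Finset.mem_univ i) hi

theorem tau_eq_zero {i j : ι} {x : U} (hx : x ∈ Φ.P i j) (hij : i ≠ j) : Φ.tau x = 0 := by
  rw [tau_apply]
  exact Finset.sum_eq_zero fun a _ => Φ.lam_eq_zero hx fun hh => hij (hh.1.trans hh.2.symm)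

theorem tau_mul_eq_zero {i j k l : ι} {x y : U} (hx : x ∈ Φ.P i j) (hy : y ∈ Φ.P k l)
    (hne : ¬ (j = k ∧ i = l)) : Φ.tau (x * y) = 0 := by
  by_cases hjk : j = k
  · subst hjk
    exact Φ.tau_eq_zero (Φ.mul_mem hx hy) fun hh => hne ⟨rfl, hh⟩
  · by_cases hh : i = k ∧ j = l
    · obtain ⟨rfl, rfl⟩ := hh
      exact Φ.tau_eq_zero (Φ.mul_mem_swap (Ne.symm hjk) hx hy) hjk
    · rw [Φ.mul_eq_zero hx hy hjk hh, map_zero]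

omit [DecidableEq ι] in
theorem lam_sub_smul_e (i : ι) (x : U) (c : F) : Φ.lam i (x - c • Φ.e i) = Φ.lam i x - c := by
  rw [map_sub, map_smul, (Φ.corner i).map_idem, smul_eq_mul, mul_one]

theorem lam_mul_comm {i j : ι} {x y : U} (hij : i ≠ j) (hx : x ∈ Φ.P i j) (hy : y ∈ Φ.P j i) :
    Φ.lam i (x * y) = Φ.lam j (y * x) := by
  by_contra hne
  set c := Φ.lam j (y * x)
  have hu : x * y - c • Φ.e i ∈ Φ.P i i :=
    sub_mem (Φ.mul_mem hx hy) (Submodule.smul_mem _ _ (Φ.e_mem i))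
  have hm : y * x - c • Φ.e j ∈ Φ.P j j :=
    sub_mem (Φ.mul_mem hy hx) (Submodule.smul_mem _ _ (Φ.e_mem j))
  set u := x * y - c • Φ.e i with hudef
  set m := y * x - c • Φ.e j with hmdef
  have hnil : IsNilElem m := by
    rw [(Φ.corner j).isNilElem_iff m hm, lam_sub_smul_e, sub_self]
  obtain ⟨v, hv, -, hvu⟩ := (Φ.corner i).exists_inv u hu (by
    rw [lam_sub_smul_e]; exact sub_ne_zero.2 hne)
  have hux : u * x = x * m := by
    rw [hudef, hmdef, sub_mul, mul_sub, smul_mul_assoc, mul_smul_comm, hx.1, hx.2,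
      Φ.alt.flexible]
  have hz : ∀ k : ℕ, (mulRight F m ^ k) x ∈ Φ.P i j ∧
      u * (mulRight F m ^ k) x = (mulRight F m ^ (k + 1)) x := by
    intro k
    induction k with
    | zero => exact ⟨hx, by simpa using hux⟩
    | succ k ih =>
      have hmem : (mulRight F m ^ (k + 1)) x ∈ Φ.P i j := by
        rw [pow_succ', Module.End.mul_apply, mulRight_apply]
        exact Φ.mul_mem ih.1 hm
      refine ⟨hmem, ?_⟩
      rw [pow_succ' _ (k + 1), Module.End.mul_apply, mulRight_apply, ← ih.2,
        Φ.mul_assoc_path hu ih.1 hm fun hh => hij hh.1, ih.2]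
      congr 1
      rw [pow_succ', Module.End.mul_apply, mulRight_apply]
  obtain ⟨k, hk⟩ := Φ.alt.isNilpotent_mulRight (F := F) hnil
  have hx0 : (mulRight F m ^ k) x = 0 := by rw [hk]; rfl
  have hback : ∀ k, (mulRight F m ^ k) x = 0 → x = 0 := by
    intro k
    induction k with
    | zero => exact fun h0 => h0
    | succ k ih =>
      intro h0
      apply ih
      have := Φ.mul_assoc_path hv hu (hz k).1 fun hh => hij hh.2
      rw [hvu, (hz k).1.1, (hz k).2, h0, mul_zero] at this
      exact this
  have := hback k hx0
  apply hne
  simp [c, this]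

theorem tau_mul_comm (x y : U) : Φ.tau (x * y) = Φ.tau (y * x) := by
  refine Φ.induction (p := fun x => Φ.tau (x * y) = Φ.tau (y * x)) (by simp)
    (fun x x' hx hx' => by rw [add_mul, mul_add, map_add, map_add, hx, hx']) ?_ x
  intro i j x hx
  refine Φ.induction (p := fun y => Φ.tau (x * y) = Φ.tau (y * x)) (by simp)
    (fun y y' hy hy' => by rw [add_mul, mul_add, map_add, map_add, hy, hy']) ?_ y
  intro k l y hy
  by_cases hh : j = k ∧ i = l
  · obtain ⟨rfl, rfl⟩ := hh
    rw [Φ.tau_eq_lam (Φ.mul_mem hx hy), Φ.tau_eq_lam (Φ.mul_mem hy hx)]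
    by_cases hij : i = j
    · subst hij
      rw [(Φ.corner i).map_mul x hx y hy, (Φ.corner i).map_mul y hy x hx, mul_comm]
    · exact Φ.lam_mul_comm hij hx hy
  · rw [Φ.tau_mul_eq_zero hx hy hh, Φ.tau_mul_eq_zero hy hx fun h' => hh ⟨h'.2.symm, h'.1.symm⟩]

theorem tau_mul_assoc_aux {i j k l p q : ι} {x y z : U} (hx : x ∈ Φ.P i j) (hy : y ∈ Φ.P k l)
    (hz : z ∈ Φ.P p q) : Φ.tau ((x * y) * z) = Φ.tau (x * (y * z)) := by
  by_cases hjk : j = k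
  · subst hjk
    have hxy := Φ.mul_mem hx hy
    by_cases hlp : l = p
    · subst hlp
      by_cases hh : i = l ∧ j = q
      · obtain ⟨rfl, rfl⟩ := hh
        by_cases hij : i = j
        · subst hij
          have hyz := Φ.mul_mem hy hz
          rw [Φ.tau_eq_lam (Φ.mul_mem hxy hz), Φ.tau_eq_lam (Φ.mul_mem hx hyz),
            (Φ.corner i).map_mul _ hxy _ hz, (Φ.corner i).map_mul _ hx _ hyz,
            (Φ.corner i).map_mul _ hx _ hy, (Φ.corner i).map_mul _ hy _ hz, mul_assoc]
        · rw [Φ.tau_eq_zero (Φ.mul_mem hxy hz) hij,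
            Φ.tau_eq_zero (Φ.mul_mem hx (Φ.mul_mem hy hz)) hij]
      · rw [Φ.mul_assoc_path hx hy hz hh]
    · rw [Φ.tau_mul_eq_zero hxy hz fun hh => hlp hh.1]
      by_cases hh : j = p ∧ l = q
      · obtain ⟨rfl, rfl⟩ := hh
        rw [Φ.tau_mul_eq_zero hx (Φ.mul_mem_swap (Ne.symm hlp) hy hz) fun hh => hlp hh.1.symm]
      · rw [Φ.mul_eq_zero hy hz hlp hh, mul_zero, map_zero]
  · by_cases hh : i = k ∧ j = l
    · obtain ⟨rfl, rfl⟩ := hh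
      have hxy := Φ.mul_mem_swap (Ne.symm hjk) hx hy
      by_cases hpq : i = p ∧ j = q
      · obtain ⟨rfl, rfl⟩ := hpq
        rw [Φ.mul_mul_cyclic (Ne.symm hjk) hx hy hz, Φ.tau_mul_comm]
      · rw [Φ.tau_mul_eq_zero hxy hz hpq]
        by_cases hjp : j = p
        · subst hjp
          rw [Φ.tau_mul_eq_zero hx (Φ.mul_mem hy hz) fun hh => hjk hh.1]
        · rw [Φ.mul_eq_zero hy hz hjp hpq, mul_zero, map_zero]
    · rw [Φ.mul_eq_zero hx hy hjk hh, zero_mul, map_zero]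
      by_cases hlp : l = p
      · subst hlp
        rw [Φ.tau_mul_eq_zero hx (Φ.mul_mem hy hz) fun hh => hjk hh.1]
      · by_cases hpq : k = p ∧ l = q
        · obtain ⟨rfl, rfl⟩ := hpq
          rw [Φ.tau_mul_eq_zero hx (Φ.mul_mem_swap (Ne.symm hlp) hy hz) fun h' =>
            hh ⟨h'.2, h'.1⟩]
        · rw [Φ.mul_eq_zero hy hz hlp hpq, mul_zero, map_zero]

theorem tau_mul_assoc (x y z : U) : Φ.tau ((x * y) * z) = Φ.tau (x * (y * z)) := by
  refine Φ.induction (p := fun x => Φ.tau ((x * y) * z) = Φ.tau (x * (y * z))) (by simp)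
    (fun x x' hx hx' => by simp only [add_mul, map_add, hx, hx']) ?_ x
  intro i j x hx
  refine Φ.induction (p := fun y => Φ.tau ((x * y) * z) = Φ.tau (x * (y * z))) (by simp)
    (fun y y' hy hy' => by simp only [mul_add, add_mul, map_add, hy, hy']) ?_ y
  intro k l y hy
  refine Φ.induction (p := fun z => Φ.tau ((x * y) * z) = Φ.tau (x * (y * z))) (by simp)
    (fun z z' hz hz' => by simp only [mul_add, map_add, hz, hz']) ?_ z
  intro p q z hz
  exact Φ.tau_mul_assoc_aux hx hy hz

omit [DecidableEq ι] in
theorem tau_eq_zero_of_nil {Z : Submodule F U} (hnil : ∀ z ∈ Z, IsNilElem z)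
    (hl : ∀ i, ∀ z ∈ Z, Φ.e i * z ∈ Z) (hr : ∀ i, ∀ z ∈ Z, z * Φ.e i ∈ Z) {z : U} (hz : z ∈ Z) :
    Φ.tau z = 0 := by
  rw [tau_apply]
  refine Finset.sum_eq_zero fun i _ => ?_
  rw [← (Φ.corner i).map_corner, ← (Φ.corner i).isNilElem_iff _ (Φ.proj_mem i i z)]
  exact hnil _ (hr i _ (hl i _ hz))

/-- The radical of the trace form. -/
def N : Submodule F U where
  carrier := {x | ∀ y, Φ.tau (x * y) = 0}
  add_mem' := by
    intro x x' hx hx' y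
    rw [add_mul, map_add, hx y, hx' y, add_zero]
  zero_mem' := by intro y; rw [zero_mul, map_zero]
  smul_mem' := by
    intro c x hx y
    rw [smul_mul_assoc, map_smul, hx y, smul_zero]

variable {Φ} in
omit [DecidableEq ι] in
theorem mem_N {x : U} : x ∈ Φ.N ↔ ∀ y, Φ.tau (x * y) = 0 := Iff.rfl

theorem mul_right_mem_N {x : U} (hx : x ∈ Φ.N) (y : U) : x * y ∈ Φ.N := fun z => by
  rw [Φ.tau_mul_assoc]; exact hx _

theorem mul_left_mem_N {x : U} (hx : x ∈ Φ.N) (y : U) : y * x ∈ Φ.N := fun z => by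
  rw [Φ.tau_mul_comm, ← Φ.tau_mul_assoc, Φ.tau_mul_comm]; exact hx _

theorem mem_N_iff_of_mem_P {i j : ι} {x : U} (hx : x ∈ Φ.P i j) :
    x ∈ Φ.N ↔ ∀ y ∈ Φ.P j i, Φ.tau (x * y) = 0 := by
  refine ⟨fun h y _ => h y, fun h y => ?_⟩
  refine Φ.induction (p := fun y => Φ.tau (x * y) = 0) (by simp)
    (fun y y' hy hy' => by rw [mul_add, map_add, hy, hy', add_zero]) ?_ y
  intro k l y hy
  by_cases hh : j = k ∧ i = l
  · obtain ⟨rfl, rfl⟩ := hh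
    exact h y hy
  · exact Φ.tau_mul_eq_zero hx hy hh

theorem mem_N_iff_lam {i : ι} {x : U} (hx : x ∈ Φ.P i i) : x ∈ Φ.N ↔ Φ.lam i x = 0 := by
  rw [Φ.mem_N_iff_of_mem_P hx]
  constructor
  · intro h
    rw [← Φ.tau_eq_lam hx]
    have := h _ (Φ.e_mem i)
    rwa [hx.2] at this
  · intro h y hy
    rw [Φ.tau_eq_lam (Φ.mul_mem hx hy), (Φ.corner i).map_mul x hx y hy, h, zero_mul]

end Frame

theorem isNilpotent_mul_swap {R : Type*} [Ring R] {a b : R} (h : IsNilpotent (a * b)) :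
    IsNilpotent (b * a) := by
  obtain ⟨n, hn⟩ := h
  have key : ∀ m, (b * a) ^ (m + 1) = b * (a * b) ^ m * a := by
    intro m
    induction m with
    | zero => simp
    | succ m ih => rw [pow_succ, ih, pow_succ]; noncomm_ring
  exact ⟨n + 1, by rw [key, hn]; simp⟩

theorem isNilpotent_sandwich {R : Type*} [Ring R] {p q : R} (hp : p * p = p) (hq : q * q = q)
    (h : IsNilpotent (q * p * q)) : IsNilpotent (p * q * p) := by
  have h1 := isNilpotent_mul_swap h
  rw [← mul_assoc, hq] at h1
  rw [← hp, ← mul_assoc] at h1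
  have h2 := isNilpotent_mul_swap h1
  rwa [← mul_assoc] at h2

namespace Frame

variable (Φ : Frame F U ι) [IsAlgClosed F] [FiniteDimensional F U]

theorem eq_zero_of_idempotent_mem_N {f : U} (hf : f * f = f) (hfN : f ∈ Φ.N) : f = 0 := by
  induction hn : Module.finrank F (range (mulLeft F f)) using Nat.strong_induction_on
    generalizing f with
  | _ n ih =>
    by_contra hf0
    have hprim : ∀ g : U, g * g = g → g ∈ peirceSpace F f f → g = 0 ∨ g = f := by
      intro g hg hgf
      by_contra! hcon
      apply hcon.1
      refine ih _ ?_ hg (by rw [← hgf.1]; exact Φ.mul_right_mem_N hfN g) rfl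
      rw [← hn]
      have h1 : (f - g) * (f - g) = f - g := by
        rw [sub_mul, mul_sub, mul_sub, hf, hg, hgf.1, hgf.2]; abel
      have h2 : (f - g) * g = 0 := by rw [sub_mul, hg, hgf.1, sub_self]
      have h3 : g * (f - g) = 0 := by rw [mul_sub, hg, hgf.2, sub_self]
      apply Submodule.finrank_lt_finrank_of_lt
      refine lt_of_le_of_ne ?_ ?_
      · rintro _ ⟨z, rfl⟩
        refine ⟨g * z, ?_⟩
        have h4 := Φ.alt.orth_mul_mul Φ.two_ne_zero h1 h2 h3 z
        rw [sub_mul, Φ.alt.idem_mul_idem_mul hg, sub_eq_zero] at h4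
        exact h4
      · intro heq
        have h4 : f - g ∈ range (mulLeft F g) := by
          rw [heq]
          exact ⟨f - g, by rw [mulLeft_apply, mul_sub, hf, hgf.1]⟩
        obtain ⟨z, hz⟩ := h4
        rw [mulLeft_apply] at hz
        have h5 := Φ.alt.idem_mul_idem_mul hg z
        rw [hz, h3] at h5
        exact hcon.2 (sub_eq_zero.1 h5.symm).symm
    obtain ⟨l, hl⟩ := Φ.alt.exists_cornerFunctional hf hf0 hprim
    have hsum : ∑ i, l (Φ.e i) = 1 := by
      rw [← map_sum, Φ.sum_one, ← hl.map_corner, mul_one, hf, hl.map_idem]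
    obtain ⟨i, -, hi⟩ := Finset.exists_ne_zero_of_sum_ne_zero (hsum.trans_ne one_ne_zero)
    apply hi
    rw [← hl.map_corner, ← hl.isNilElem_iff _ (Φ.alt.corner_proj_mem hf _)]
    have hv : IsNilElem ((Φ.e i * f) * Φ.e i) := by
      rw [(Φ.corner i).isNilElem_iff _ (Φ.proj_mem i i f), ← Φ.mem_N_iff_lam (Φ.proj_mem i i f)]
      exact Φ.mul_right_mem_N (Φ.mul_left_mem_N hfN _) _
    have hsand : ∀ x y : U, mulLeft F ((x * y) * x) = mulLeft F x * mulLeft F y * mulLeft F x := by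
      intro x y; ext z; simp [Φ.alt.moufang_left]
    have hidem : ∀ x : U, x * x = x → mulLeft F x * mulLeft F x = mulLeft F x := by
      intro x hx; ext z; simp [Φ.alt.idem_mul_idem_mul hx]
    have hv' := Φ.alt.isNilpotent_mulLeft (F := F) hv
    apply IsAlternative.isNilElem_of_mulLeft (F := F)
    rw [hsand] at hv' ⊢
    exact isNilpotent_sandwich (hidem f hf) (hidem _ (Φ.mul_self i)) hv'

theorem isNilElem_of_mem_N {x : U} (hx : x ∈ Φ.N) : IsNilElem x := by
  by_contra hnil
  obtain ⟨q, hq0, hq⟩ := Φ.alt.exists_idempotent (F := F) hnil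
  refine hq0 (Φ.eq_zero_of_idempotent_mem_N hq ?_)
  rw [Φ.alt.altEval_mul]
  apply Φ.mul_right_mem_N
  have : altEval (F := F) x Polynomial.X = x := by
    simpa [lpow] using altEval_X_pow_succ (F := F) x 0
  rw [this]
  exact hx

end Frame

end TraceForm

section WedderburnPrincipal

open LinearMap

variable {F : Type*} [Field F] {U : Type*} [NonAssocRing U] [Module F U]
  [SMulCommClass F U U] [IsScalarTower F U U] {ι : Type*} [Fintype ι] [DecidableEq ι]

namespace PeirceFamily

variable (E : PeirceFamily F U ι)

theorem mul_mul_cyclic' {i j : ι} (hij : i ≠ j) {x y z : U} (hx : x ∈ E.P i j)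
    (hy : y ∈ E.P i j) (hz : z ∈ E.P i j) : x * (y * z) = y * (z * x) := by
  have h1 := E.alt.associator_rotate x y z
  simp only [associator] at h1
  rw [E.mul_mul_cyclic hij hx hy hz] at h1
  exact (sub_right_inj.1 h1).symm

/-- Off-diagonal products vanish in the presence of a third linked idempotent. -/
theorem mul_eq_zero_of_third {i j k : ι} (hij : i ≠ j) (hki : k ≠ i) (hkj : k ≠ j) {a b x y : U}
    (ha : a ∈ E.P i k) (hb : b ∈ E.P k i) (hab : a * b = E.e i) (hx : x ∈ E.P i j)
    (hy : y ∈ E.P i j) : x * y = 0 := by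
  have hby := E.mul_mem hb hy
  have h1 : y = a * (b * y) := by
    rw [← E.mul_assoc_path ha hb hy fun hh => hkj hh.2, hab, hy.1]
  have h3 := E.alt.associator_swap_left a x (b * y)
  rw [associator, associator, E.mul_eq_zero ha hx hki fun hh => hkj hh.2,
    E.mul_eq_zero hx hby (Ne.symm hkj) fun hh => hki hh.1.symm,
    E.mul_eq_zero hx ha (Ne.symm hij) fun hh => hkj hh.2.symm] at h3
  rw [h1]
  simpa using h3

end PeirceFamily

namespace Frame

variable (Φ : Frame F U ι)

theorem e_not_mem_N (i : ι) : Φ.e i ∉ Φ.N := by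
  rw [Φ.mem_N_iff_lam (Φ.e_mem i), (Φ.corner i).map_idem]
  exact one_ne_zero

theorem sub_lam_smul_mem_N {i : ι} {x : U} (hx : x ∈ Φ.P i i) :
    x - Φ.lam i x • Φ.e i ∈ Φ.N := by
  rw [Φ.mem_N_iff_lam (sub_mem hx (Submodule.smul_mem _ _ (Φ.e_mem i))), lam_sub_smul_e, sub_self]

omit [DecidableEq ι] in
theorem eq_e_of_idempotent {i : ι} {f : U} (hf : f ∈ Φ.P i i) (hff : f * f = f)
    (hl : Φ.lam i f ≠ 0) : f = Φ.e i := by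
  obtain ⟨d, -, hd, -⟩ := (Φ.corner i).exists_inv f hf hl
  have h1 := Φ.alt.idem_mul_idem_mul hff d
  rw [hd, hf.2] at h1
  exact h1

/-- Two idempotents of the frame are linked if they are connected by mutually inverse elements. -/
def Linked (i j : ι) : Prop :=
  ∃ a ∈ Φ.P i j, ∃ b ∈ Φ.P j i, a * b = Φ.e i ∧ b * a = Φ.e j

theorem exists_inverse {i j : ι} (hij : i ≠ j) {x : U} (hx : x ∈ Φ.P i j) (hxN : x ∉ Φ.N) :
    ∃ c ∈ Φ.P j i, x * c = Φ.e i ∧ c * x = Φ.e j := by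
  rw [Φ.mem_N_iff_of_mem_P hx] at hxN
  push Not at hxN
  obtain ⟨y, hy, hxy⟩ := hxN
  have hm := Φ.mul_mem hx hy
  rw [Φ.tau_eq_lam hm] at hxy
  obtain ⟨d, hd, hd1, -⟩ := (Φ.corner i).exists_inv _ hm hxy
  have hc := Φ.mul_mem hy hd
  have h1 : x * (y * d) = Φ.e i := by
    rw [← Φ.mul_assoc_path hx hy hd fun hh => hij hh.2.symm, hd1]
  refine ⟨y * d, hc, h1, Φ.eq_e_of_idempotent (Φ.mul_mem hc hx) ?_ ?_⟩
  · rw [Φ.mul_assoc_path hc hx (Φ.mul_mem hc hx) fun hh => hij hh.2, ← Φ.alt.flexible x, h1, hx.1]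
  · rw [← Φ.lam_mul_comm hij hx hc, h1, (Φ.corner i).map_idem]
    exact one_ne_zero

theorem linked_of_not_mem_N {i j : ι} (hij : i ≠ j) {x : U} (hx : x ∈ Φ.P i j)
    (hxN : x ∉ Φ.N) : Φ.Linked i j := by
  obtain ⟨c, hc, h1, h3⟩ := Φ.exists_inverse hij hx hxN
  exact ⟨x, hx, c, hc, h1, h3⟩

variable {Φ}

omit [DecidableEq ι] in
theorem Linked.symm {i j : ι} (h : Φ.Linked i j) : Φ.Linked j i := by
  obtain ⟨a, ha, b, hb, h1, h3⟩ := h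
  exact ⟨b, hb, a, ha, h3, h1⟩

omit [DecidableEq ι] in
theorem Linked.refl (i : ι) : Φ.Linked i i :=
  ⟨_, Φ.e_mem i, _, Φ.e_mem i, Φ.mul_self i, Φ.mul_self i⟩

theorem Linked.trans {i j k : ι} (h : Φ.Linked i j) (h' : Φ.Linked j k) : Φ.Linked i k := by
  by_cases hik : i = k
  · subst hik; exact Linked.refl i
  obtain ⟨a, ha, b, hb, h1, h3⟩ := h
  obtain ⟨a', ha', b', hb', h1', h3'⟩ := h'
  by_cases hij : i = j
  · subst hij; exact ⟨a', ha', b', hb', h1', h3'⟩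
  by_cases hjk : j = k
  · subst hjk; exact ⟨a, ha, b, hb, h1, h3⟩
  refine ⟨_, Φ.mul_mem ha ha', _, Φ.mul_mem hb' hb, ?_, ?_⟩
  · rw [Φ.mul_assoc_path ha ha' (Φ.mul_mem hb' hb) fun hh => hik hh.1,
      ← Φ.mul_assoc_path ha' hb' hb fun hh => hik hh.2.symm, h1', hb.1, h1]
  · rw [Φ.mul_assoc_path hb' hb (Φ.mul_mem ha ha') fun hh => hik hh.1.symm,
      ← Φ.mul_assoc_path hb ha ha' fun hh => hik hh.2, h3, ha'.1, h3']

variable (Φ)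

theorem mul_not_mem_N {i j : ι} (hij : i ≠ j) {x z : U} (hx : x ∈ Φ.P i j) (hz : z ∈ Φ.P i j)
    (hxN : x ∉ Φ.N) (hxz : ∀ c : F, z - c • x ∉ Φ.N) : x * z ∉ Φ.N := by
  have hexists : ∃ y ∈ Φ.P j i, Φ.tau (x * y) = 0 ∧ Φ.tau (z * y) ≠ 0 := by
    by_contra! hcon
    obtain ⟨y₀, hy₀, hxy₀⟩ : ∃ y ∈ Φ.P j i, Φ.tau (x * y) ≠ 0 := by
      rw [Φ.mem_N_iff_of_mem_P hx] at hxN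
      push Not at hxN
      exact hxN
    refine hxz (Φ.tau (z * y₀) / Φ.tau (x * y₀)) ?_
    rw [Φ.mem_N_iff_of_mem_P (sub_mem hz (Submodule.smul_mem _ _ hx))]
    intro y hy
    have h1 := hcon (y - (Φ.tau (x * y) / Φ.tau (x * y₀)) • y₀)
      (sub_mem hy (Submodule.smul_mem _ _ hy₀)) (by
        rw [mul_sub, mul_smul_comm, map_sub, map_smul, smul_eq_mul, div_mul_cancel₀ _ hxy₀,
          sub_self])
    rw [mul_sub, mul_smul_comm, map_sub, map_smul, smul_eq_mul] at h1
    rw [sub_mul, smul_mul_assoc, map_sub, map_smul, smul_eq_mul, ← h1]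
    ring
  obtain ⟨y, hy, hxy, hzy⟩ := hexists
  intro hN
  have h1 := Φ.swap_mul_eq_sub hij hx hz hy
  have h3 := Φ.mul_right_mem_N hN y
  have hxy' : x * y ∈ Φ.N := by
    rw [Φ.mem_N_iff_lam (Φ.mul_mem hx hy), ← Φ.tau_eq_lam (Φ.mul_mem hx hy), hxy]
  have h4 : x * (y * z) ∈ Φ.N := by
    have := add_mem h3 (Φ.mul_right_mem_N hxy' z)
    rwa [h1, sub_add_cancel] at this
  have hyz := Φ.mul_mem hy hz
  have h5 := Φ.mul_left_mem_N (Φ.sub_lam_smul_mem_N hyz) x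
  rw [mul_sub, mul_smul_comm, hx.2] at h5
  have h6 := sub_mem h4 h5
  rw [sub_sub_cancel, ← Φ.tau_eq_lam hyz, Φ.tau_mul_comm] at h6
  have h7 := Submodule.smul_mem _ (Φ.tau (z * y))⁻¹ h6
  rw [smul_smul, inv_mul_cancel₀ hzy, one_smul] at h7
  exact hxN h7

theorem mem_N_of_octonion_dual {i j : ι} (hij : i ≠ j) {x y₁ y₂ y₃ z : U} (c : F)
    (hx : x ∈ Φ.P i j) (hy₁ : y₁ ∈ Φ.P j i) (hy₂ : y₂ ∈ Φ.P j i) (hy₃ : y₃ ∈ Φ.P j i)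
    (hz : z ∈ Φ.P i j) (hxy : x * y₁ = Φ.e i) (hxc : x = c • (y₂ * y₃))
    (h₁ : Φ.lam j (y₁ * z) = 0) (h₂ : Φ.lam j (y₂ * z) = 0) (h₃ : Φ.lam j (y₃ * z) = 0) :
    z ∈ Φ.N := by
  have hN : ∀ y ∈ Φ.P j i, Φ.lam j (y * z) = 0 → y * z ∈ Φ.N := fun y hy h0 => by
    rwa [Φ.mem_N_iff_lam (Φ.mul_mem hy hz)]
  have hxz : x * z ∈ Φ.N := by
    rw [hxc, smul_mul_assoc, Φ.swap_mul_eq_sub (Ne.symm hij) hy₂ hy₃ hz]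
    refine Submodule.smul_mem _ _ (sub_mem (Φ.mul_left_mem_N ?_ _)
      (Φ.mul_right_mem_N (hN y₂ hy₂ h₂) _))
    rwa [Φ.mem_N_iff_lam (Φ.mul_mem hz hy₃), Φ.lam_mul_comm hij hz hy₃]
  have h4 := Φ.swap_mul_eq_sub hij hx hz hy₁
  rw [hxy, hz.1] at h4
  have h5 := sub_mem (Φ.mul_left_mem_N (hN y₁ hy₁ h₁) x) (Φ.mul_right_mem_N hxz y₁)
  rwa [h4, sub_sub_cancel] at h5

/-- A complement of the radical in a pair of opposite Peirce components which, together with the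
two idempotents, spans a split octonion algebra. -/
structure Octonion (i j : ι) (X Y : Submodule F U) : Prop where
  ne : i ≠ j
  X_le : X ≤ Φ.P i j
  Y_le : Y ≤ Φ.P j i
  XX : ∀ x ∈ X, ∀ x' ∈ X, x * x' ∈ Y
  YY : ∀ y ∈ Y, ∀ y' ∈ Y, y * y' ∈ X
  XY : ∀ x ∈ X, ∀ y ∈ Y, x * y ∈ Submodule.span F {Φ.e i}
  YX : ∀ y ∈ Y, ∀ x ∈ X, y * x ∈ Submodule.span F {Φ.e j}
  X_inf : ∀ x ∈ X, x ∈ Φ.N → x = 0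
  Y_inf : ∀ y ∈ Y, y ∈ Φ.N → y = 0
  X_sup : Φ.P i j ≤ X ⊔ Φ.N
  Y_sup : Φ.P j i ≤ Y ⊔ Φ.N
  X_ne : ∃ x ∈ X, ∃ x' ∈ X, x * x' ≠ 0
  Y_ne : ∃ y ∈ Y, ∃ y' ∈ Y, y * y' ≠ 0

variable {Φ} in
omit [DecidableEq ι] in
theorem Octonion.swap {i j : ι} {X Y : Submodule F U} (h : Φ.Octonion i j X Y) :
    Φ.Octonion j i Y X :=
  ⟨h.ne.symm, h.Y_le, h.X_le, h.YY, h.XX, h.YX, h.XY, h.Y_inf, h.X_inf, h.Y_sup, h.X_sup,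
    h.Y_ne, h.X_ne⟩

variable {Φ} in
theorem Octonion.linked {i j : ι} {X Y : Submodule F U} (h : Φ.Octonion i j X Y) :
    Φ.Linked i j := by
  obtain ⟨x, hx, x', hx', hne⟩ := h.X_ne
  refine Φ.linked_of_not_mem_N h.ne (h.X_le hx) fun hN => hne ?_
  rw [h.X_inf x hx hN, zero_mul]

variable {Φ} in
theorem Octonion.eq_of_linked {i j k : ι} {X Y : Submodule F U} (h : Φ.Octonion i j X Y)
    (hk : Φ.Linked i k) : k = i ∨ k = j := by
  by_contra! hcon
  obtain ⟨x, hx, x', hx', hne⟩ := h.X_ne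
  obtain ⟨a, ha, b, hb, hab, -⟩ := hk
  exact hne (Φ.mul_eq_zero_of_third h.ne hcon.1 hcon.2 ha hb hab (h.X_le hx) (h.X_le hx'))

omit [DecidableEq ι] in
theorem mul_mem_of_mem_span {s t : Set U} {Z : Submodule F U}
    (h : ∀ a ∈ s, ∀ b ∈ t, a * b ∈ Z) {a b : U} (ha : a ∈ Submodule.span F s)
    (hb : b ∈ Submodule.span F t) : a * b ∈ Z := by
  induction ha using Submodule.span_induction with
  | mem a ha =>
    induction hb using Submodule.span_induction with
    | mem b hb => exact h a ha b hb
    | zero => rw [mul_zero]; exact Z.zero_mem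
    | add b b' _ _ hb hb' => rw [mul_add]; exact add_mem hb hb'
    | smul c b _ hb => rw [mul_smul_comm]; exact Z.smul_mem c hb
  | zero => rw [zero_mul]; exact Z.zero_mem
  | add a a' _ _ ha ha' => rw [add_mul]; exact add_mem ha ha'
  | smul c a _ ha => rw [smul_mul_assoc]; exact Z.smul_mem c ha

theorem half_octonion_of_table {i j : ι} (hij : i ≠ j) (x y : Fin 3 → U) (c d : F) (hc : c ≠ 0)
    (hd : d ≠ 0) (hx : ∀ k, x k ∈ Φ.P i j) (hy : ∀ k, y k ∈ Φ.P j i)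
    (hxx : ∀ k, x k * x (k + 1) = c • y (k + 2)) (hyy : ∀ k, y k * y (k + 1) = d • x (k + 2))
    (hxy : ∀ k l, x k * y l = if k = l then Φ.e i else 0)
    (hyx : ∀ k l, y k * x l = if k = l then Φ.e j else 0) :
    (∀ a ∈ Submodule.span F (Set.range x), ∀ b ∈ Submodule.span F (Set.range x),
      a * b ∈ Submodule.span F (Set.range y)) ∧
    (∀ a ∈ Submodule.span F (Set.range x), ∀ b ∈ Submodule.span F (Set.range y),
      a * b ∈ Submodule.span F {Φ.e i}) ∧
    (∀ a ∈ Submodule.span F (Set.range x), a ∈ Φ.N → a = 0) ∧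
    Φ.P i j ≤ Submodule.span F (Set.range x) ⊔ Φ.N ∧
    ∃ a ∈ Submodule.span F (Set.range x), ∃ b ∈ Submodule.span F (Set.range x), a * b ≠ 0 := by
  refine ⟨fun a ha b hb => mul_mem_of_mem_span ?_ ha hb,
    fun a ha b hb => mul_mem_of_mem_span ?_ ha hb, ?_, ?_, ?_⟩
  · rintro _ ⟨k, rfl⟩ _ ⟨l, rfl⟩
    have hkl : ∀ k l : Fin 3, l = k ∨ l = k + 1 ∨ k = l + 1 := by decide
    rcases hkl k l with rfl | rfl | rfl
    · rw [Φ.mul_self_eq_zero hij (hx l)]; exact Submodule.zero_mem _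
    · rw [hxx]; exact Submodule.smul_mem _ _ (Submodule.subset_span ⟨_, rfl⟩)
    · rw [Φ.mul_anticomm hij (hx _) (hx _), hxx]
      exact Submodule.neg_mem _ (Submodule.smul_mem _ _ (Submodule.subset_span ⟨_, rfl⟩))
  · rintro _ ⟨k, rfl⟩ _ ⟨l, rfl⟩
    rw [hxy]
    split_ifs
    · exact Submodule.mem_span_singleton_self _
    · exact Submodule.zero_mem _
  · intro a ha haN
    obtain ⟨g, rfl⟩ := (Submodule.mem_span_range_iff_exists_fun F).1 ha
    refine Finset.sum_eq_zero fun l _ => ?_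
    have h1 := Φ.mul_left_mem_N haN (y l)
    simp only [Finset.mul_sum, mul_smul_comm, hyx, smul_ite, smul_zero, Finset.sum_ite_eq,
      Finset.mem_univ, if_true] at h1
    by_cases hg : g l = 0
    · rw [hg, zero_smul]
    · have h3 := Submodule.smul_mem _ (g l)⁻¹ h1
      rw [smul_smul, inv_mul_cancel₀ hg, one_smul] at h3
      exact absurd h3 (Φ.e_not_mem_N j)
  · intro z hz
    have hs : ∑ k, Φ.lam j (y k * z) • x k ∈ Submodule.span F (Set.range x) :=
      Submodule.sum_mem _ fun k _ => Submodule.smul_mem _ _ (Submodule.subset_span ⟨k, rfl⟩)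
    have hsP : ∑ k, Φ.lam j (y k * z) • x k ∈ Φ.P i j :=
      Submodule.sum_mem _ fun k _ => Submodule.smul_mem _ _ (hx k)
    rw [← add_sub_cancel (∑ k, Φ.lam j (y k * z) • x k) z]
    refine Submodule.add_mem_sup hs ?_
    have h0 : ∀ l, Φ.lam j (y l * (z - ∑ k, Φ.lam j (y k * z) • x k)) = 0 := by
      intro l
      simp only [mul_sub, Finset.mul_sum, mul_smul_comm, hyx, smul_ite, smul_zero,
        Finset.sum_ite_eq, Finset.mem_univ, if_true]
      rw [lam_sub_smul_e, sub_self]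
    refine Φ.mem_N_of_octonion_dual hij d⁻¹ (hx 2) (hy 2) (hy 0) (hy 1) (sub_mem hz hsP) ?_ ?_
      (h0 _) (h0 _) (h0 _)
    · rw [hxy, if_pos rfl]
    · rw [show y 0 * y 1 = d • x 2 from hyy 0, smul_smul, inv_mul_cancel₀ hd, one_smul]
  · refine ⟨x 0, Submodule.subset_span ⟨0, rfl⟩, x 1, Submodule.subset_span ⟨1, rfl⟩, ?_⟩
    rw [show x 0 * x 1 = c • y 2 from hxx 0]
    refine smul_ne_zero hc fun h0 => Φ.e_not_mem_N i ?_
    have := hxy 2 2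
    rw [if_pos rfl, h0, mul_zero] at this
    rw [← this]
    exact Submodule.zero_mem _

/-- Three vectors with the multiplication table of the vector part of a split octonion algebra,
together with the dual triple. -/
theorem exists_octonion_of_table {i j : ι} (hij : i ≠ j) (x y : Fin 3 → U)
    (hx : ∀ k, x k ∈ Φ.P i j) (hy : ∀ k, y k ∈ Φ.P j i)
    (hxx : ∀ k, x k * x (k + 1) = y (k + 2)) (hyy : ∀ k, y k * y (k + 1) = -x (k + 2))
    (hxy : ∀ k l, x k * y l = if k = l then Φ.e i else 0)
    (hyx : ∀ k l, y k * x l = if k = l then Φ.e j else 0) :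
    Φ.Octonion i j (Submodule.span F (Set.range x)) (Submodule.span F (Set.range y)) := by
  obtain ⟨h1, h3, h4, h5, h6⟩ := Φ.half_octonion_of_table hij x y 1 (-1) one_ne_zero
    (neg_ne_zero.2 one_ne_zero) hx hy (by simpa using hxx) (by simpa using hyy) hxy hyx
  obtain ⟨k1, k3, k4, k5, k6⟩ := Φ.half_octonion_of_table hij.symm y x (-1) 1
    (neg_ne_zero.2 one_ne_zero) one_ne_zero hy hx (by simpa using hyy) (by simpa using hxx) hyx hxy
  refine ⟨hij, ?_, ?_, h1, k1, h3, k3, h4, k4, h5, k5, h6, k6⟩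
  · rw [Submodule.span_le]; rintro _ ⟨k, rfl⟩; exact hx k
  · rw [Submodule.span_le]; rintro _ ⟨k, rfl⟩; exact hy k

theorem exists_octonion {i j : ι} (hij : i ≠ j) {x₁ x₂ : U} (hx₁ : x₁ ∈ Φ.P i j)
    (hx₂ : x₂ ∈ Φ.P i j) (hN : x₁ ∉ Φ.N) (hN' : ∀ c : F, x₂ - c • x₁ ∉ Φ.N) :
    ∃ X Y, Φ.Octonion i j X Y := by
  have hm := Φ.mul_mem_swap hij hx₁ hx₂
  obtain ⟨x₃, hx₃, h1, h3⟩ := Φ.exists_inverse hij.symm hm (Φ.mul_not_mem_N hij hx₁ hx₂ hN hN')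
  have hxm : ∀ k, (![x₁, x₂, x₃] : Fin 3 → U) k ∈ Φ.P i j := by
    intro k; fin_cases k
    exacts [hx₁, hx₂, hx₃]
  have z1 := Φ.mul_self_eq_zero hij hx₁
  have z2 := Φ.mul_self_eq_zero hij hx₂
  have z3 := Φ.mul_self_eq_zero hij hx₃
  have a12 := Φ.mul_anticomm hij hx₁ hx₂
  have a23 := Φ.mul_anticomm hij hx₂ hx₃
  have a31 := Φ.mul_anticomm hij hx₃ hx₁
  have lz : ∀ x z : U, x * x = 0 → x * (x * z) = 0 := fun x z h0 => by
    rw [← (Φ.alt x z).1, h0, zero_mul]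
  have rz : ∀ x z : U, x * x = 0 → (z * x) * x = 0 := fun x z h0 => by
    rw [(Φ.alt x z).2, h0, mul_zero]
  have c1 := Φ.mul_mul_cyclic hij hx₁ hx₂ hx₃
  have c2 := Φ.mul_mul_cyclic hij hx₂ hx₃ hx₁
  have d1 := Φ.mul_mul_cyclic' hij hx₁ hx₂ hx₃
  have d2 := Φ.mul_mul_cyclic' hij hx₂ hx₃ hx₁
  have hyy : ∀ p q r : U, p ∈ Φ.P i j → q ∈ Φ.P i j → r ∈ Φ.P i j → p * (q * r) = Φ.e i →
      (r * p) * (p * q) = -p := by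
    intro p q r hp hq hr hpqr
    rw [Φ.mul_anticomm hij hr hp, Φ.mul_anticomm hij hp hq, neg_mul_neg, Φ.alt.moufang_middle,
      Φ.mul_anticomm hij hr hq, mul_neg, hpqr, neg_mul, hp.1]
  refine ⟨_, _, Φ.exists_octonion_of_table hij ![x₁, x₂, x₃] ![x₂ * x₃, x₃ * x₁, x₁ * x₂] hxm
    ?_ ?_ ?_ ?_ ?_⟩
  · intro k; fin_cases k
    exacts [Φ.mul_mem_swap hij hx₂ hx₃, Φ.mul_mem_swap hij hx₃ hx₁, hm]
  · intro k; fin_cases k <;> rfl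
  · intro k; fin_cases k
    exacts [hyy x₃ x₁ x₂ hx₃ hx₁ hx₂ h3, hyy x₁ x₂ x₃ hx₁ hx₂ hx₃ (by rw [d1, d2, h3]),
      hyy x₂ x₃ x₁ hx₂ hx₃ hx₁ (by rw [d2, h3])]
  · intro k l
    fin_cases k <;> fin_cases l <;> simp
    · rw [d1, d2, h3]
    · rw [a31, mul_neg, lz _ _ z1, neg_zero]
    · exact lz _ _ z1
    · exact lz _ _ z2
    · rw [d2, h3]
    · rw [a12, mul_neg, lz _ _ z2, neg_zero]
    · rw [a23, mul_neg, lz _ _ z3, neg_zero]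
    · exact lz _ _ z3
    · exact h3
  · intro k l
    fin_cases k <;> fin_cases l <;> simp
    · rw [← c1, h1]
    · rw [a23, neg_mul, rz _ _ z2, neg_zero]
    · exact rz _ _ z3
    · exact rz _ _ z1
    · rw [← c2, ← c1, h1]
    · rw [a31, neg_mul, rz _ _ z3, neg_zero]
    · rw [a12, neg_mul, rz _ _ z1, neg_zero]
    · exact rz _ _ z2
    · exact h1

/-- Compatible complements of the radical in all Peirce components. -/
theorem exists_principal_components : ∃ T : ι → ι → Submodule F U,
    (∀ i j, T i j ≤ Φ.P i j) ∧ (∀ i, Φ.e i ∈ T i i) ∧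
    (∀ i j k, ∀ u ∈ T i j, ∀ v ∈ T j k, u * v ∈ T i k) ∧
    (∀ i j, i ≠ j → ∀ u ∈ T i j, ∀ v ∈ T i j, u * v ∈ T j i) ∧
    (∀ i j, ∀ u ∈ T i j, u ∈ Φ.N → u = 0) ∧ (∀ i j, Φ.P i j ≤ T i j ⊔ Φ.N) := by
  classical
  let Thick : ι → ι → Prop := fun i j => ∃ X Y, Φ.Octonion i j X Y
  have thick_symm : ∀ i j, Thick i j → Thick j i := fun i j ⟨X, Y, h⟩ => ⟨Y, X, h.swap⟩
  have hthick : ∀ i j, ∃ XY : Submodule F U × Submodule F U,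
      Thick i j → Φ.Octonion i j XY.1 XY.2 := by
    intro i j
    by_cases h : Thick i j
    · obtain ⟨X, Y, h⟩ := h; exact ⟨(X, Y), fun _ => h⟩
    · exact ⟨(⊥, ⊥), fun h' => absurd h' h⟩
  choose O hO using hthick
  let R : Setoid ι := ⟨Φ.Linked, Linked.refl, Linked.symm, Linked.trans⟩
  let r : ι → ι := fun i => (Quotient.mk R i).out
  have hr : ∀ i, Φ.Linked i (r i) := fun i => (Quotient.mk_out (s := R) i).symm
  have hr' : ∀ i j, Φ.Linked i j → r i = r j := fun i j hij => by
    show (Quotient.mk R i).out = (Quotient.mk R j).out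
    rw [Quotient.sound (s := R) hij]
  choose a ha b hb hab hba using hr
  have hp : ∀ i j, Φ.Linked i j → a i * b j ∈ Φ.P i j := fun i j hij => by
    have h1 := hb j
    rw [← hr' i j hij] at h1
    exact Φ.mul_mem (ha i) h1
  have hpp : ∀ i j k, i ≠ j → j ≠ k → Φ.Linked i j → Φ.Linked j k →
      (a i * b j) * (a j * b k) = a i * b k := by
    intro i j k hij hjk h1 h3
    have hbj := hb j
    have haj := ha j
    have hbk := hb k
    have hbaj := hba j
    rw [← hr' i j h1] at hbj haj hbaj
    rw [← hr' j k h3, ← hr' i j h1] at hbk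
    rw [← Φ.mul_assoc_path (hp i j h1) haj hbk fun hh => hjk hh.2,
      Φ.mul_assoc_path (ha i) hbj haj fun hh => hij hh.1, hbaj, (ha i).2]
  have hpN : ∀ i j, i ≠ j → Φ.Linked i j → a i * b j ∉ Φ.N := by
    intro i j hij h1 hN
    have := Φ.mul_right_mem_N hN (a j * b i)
    rw [hpp i j i hij hij.symm h1 h1.symm, hab] at this
    exact Φ.e_not_mem_N i this
  let n := Fintype.equivFin ι
  let D : ι → ι → Submodule F U := fun i j => if n i < n j then (O i j).1 else (O j i).2
  have hD : ∀ i j, Thick i j → Φ.Octonion i j (D i j) (D j i) := by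
    intro i j h
    have hne : i ≠ j := by obtain ⟨X, Y, h⟩ := h; exact h.ne
    rcases lt_or_gt_of_ne (fun hh => hne (n.injective hh)) with hlt | hlt
    · simp only [D, if_pos hlt, if_neg hlt.not_gt]; exact hO i j h
    · simp only [D, if_pos hlt, if_neg hlt.not_gt]; exact (hO j i (thick_symm i j h)).swap
  have iso : ∀ i j k, Thick i j → Φ.Linked i k → k = i ∨ k = j :=
    fun i j k h hk => (hD i j h).eq_of_linked hk
  have thick_ne : ∀ i j, Thick i j → i ≠ j := fun i j h => (hD i j h).ne
  let T : ι → ι → Submodule F U := fun i j =>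
    if i = j then Submodule.span F {Φ.e i} else if Thick i j then D i j else
      if Φ.Linked i j then Submodule.span F {a i * b j} else ⊥
  have T_diag : ∀ i, T i i = Submodule.span F {Φ.e i} := fun i => if_pos rfl
  have T_thick : ∀ i j, Thick i j → T i j = D i j := fun i j h => by
    simp only [T, if_neg (thick_ne i j h), if_pos h]
  have T_thin : ∀ i j, i ≠ j → ¬ Thick i j → Φ.Linked i j →
      T i j = Submodule.span F {a i * b j} := fun i j hij h hl => by
    simp only [T, if_neg hij, if_neg h, if_pos hl]
  have T_bot : ∀ i j, i ≠ j → ¬ Φ.Linked i j → T i j = ⊥ := fun i j hij hl => by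
    simp only [T, if_neg hij, if_neg (fun h => hl (hD i j h).linked), if_neg hl]
  have cases_T : ∀ i j (p : Prop), (i = j → p) → (Thick i j → p) →
      (i ≠ j → ¬ Thick i j → Φ.Linked i j → p) → (i ≠ j → ¬ Φ.Linked i j → p) → p := by
    intro i j p
    tauto
  have hTP : ∀ i j, T i j ≤ Φ.P i j := by
    intro i j
    apply cases_T i j
    · rintro rfl
      rw [T_diag, Submodule.span_singleton_le_iff_mem]
      exact Φ.e_mem i
    · intro h
      rw [T_thick i j h]
      exact (hD i j h).X_le
    · intro hij h hl
      rw [T_thin i j hij h hl, Submodule.span_singleton_le_iff_mem]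
      exact hp i j hl
    · intro hij hl
      rw [T_bot i j hij hl]
      exact bot_le
  refine ⟨T, hTP, fun i => ?_, ?_, ?_, ?_, ?_⟩
  · rw [T_diag]
    exact Submodule.mem_span_singleton_self _
  · intro i j k u hu v hv
    have hu' := hTP i j hu
    have hv' := hTP j k hv
    apply cases_T i j
    · rintro rfl
      rw [T_diag, Submodule.mem_span_singleton] at hu
      obtain ⟨c, rfl⟩ := hu
      rw [smul_mul_assoc, hv'.1]
      exact Submodule.smul_mem _ c hv
    · intro h
      apply cases_T j k
      · rintro rfl
        rw [T_diag, Submodule.mem_span_singleton] at hv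
        obtain ⟨c, rfl⟩ := hv
        rw [mul_smul_comm, hu'.2]
        exact Submodule.smul_mem _ c hu
      · intro h3
        obtain rfl | rfl := iso j i k (thick_symm i j h) (hD j k h3).linked
        · exact absurd rfl (thick_ne _ _ h3)
        · rw [T_thick _ _ h] at hu
          rw [T_thick _ _ h3] at hv
          rw [T_diag]
          exact (hD _ _ h).XY u hu v hv
      · intro hjk h3 hl
        obtain rfl | rfl := iso j i k (thick_symm i j h) hl
        · exact absurd rfl hjk
        · exact absurd (thick_symm _ _ h) h3
      · intro hjk hl
        rw [T_bot j k hjk hl, Submodule.mem_bot] at hv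
        rw [hv, mul_zero]
        exact Submodule.zero_mem _
    · intro hij h hl
      apply cases_T j k
      · rintro rfl
        rw [T_diag, Submodule.mem_span_singleton] at hv
        obtain ⟨c, rfl⟩ := hv
        rw [mul_smul_comm, hu'.2]
        exact Submodule.smul_mem _ c hu
      · intro h3
        obtain rfl | rfl := iso j k i h3 hl.symm
        · exact absurd rfl hij
        · exact absurd (thick_symm _ _ h3) h
      · intro hjk h3 hl'
        rw [T_thin i j hij h hl, Submodule.mem_span_singleton] at hu
        rw [T_thin j k hjk h3 hl', Submodule.mem_span_singleton] at hv
        obtain ⟨c, rfl⟩ := hu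
        obtain ⟨c', rfl⟩ := hv
        rw [smul_mul_smul_comm, hpp i j k hij hjk hl hl']
        refine Submodule.smul_mem _ _ ?_
        by_cases hik : i = k
        · subst hik
          rw [hab, T_diag]
          exact Submodule.mem_span_singleton_self _
        · have h4 : ¬ Thick i k := fun h4 => by
            obtain rfl | rfl := iso i k j h4 hl
            · exact hij rfl
            · exact hjk rfl
          rw [T_thin i k hik h4 (hl.trans hl')]
          exact Submodule.mem_span_singleton_self _
      · intro hjk hl'
        rw [T_bot j k hjk hl', Submodule.mem_bot] at hv
        rw [hv, mul_zero]
        exact Submodule.zero_mem _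
    · intro hij hl
      rw [T_bot i j hij hl, Submodule.mem_bot] at hu
      rw [hu, zero_mul]
      exact Submodule.zero_mem _
  · intro i j hij u hu v hv
    apply cases_T i j
    · exact fun h => absurd h hij
    · intro h
      rw [T_thick i j h] at hu hv
      rw [T_thick j i (thick_symm i j h)]
      exact (hD i j h).XX u hu v hv
    · intro _ h hl
      rw [T_thin i j hij h hl, Submodule.mem_span_singleton] at hu hv
      obtain ⟨c, rfl⟩ := hu
      obtain ⟨c', rfl⟩ := hv
      rw [smul_mul_smul_comm, Φ.mul_self_eq_zero hij (hp i j hl), smul_zero]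
      exact Submodule.zero_mem _
    · intro _ hl
      rw [T_bot i j hij hl, Submodule.mem_bot] at hu
      rw [hu, zero_mul]
      exact Submodule.zero_mem _
  · intro i j u hu huN
    have aux : ∀ w : U, w ∉ Φ.N → u ∈ Submodule.span F {w} → u = 0 := by
      intro w hw hu
      obtain ⟨c, rfl⟩ := Submodule.mem_span_singleton.1 hu
      by_contra h0
      have hc : c ≠ 0 := fun hc => h0 (by rw [hc, zero_smul])
      exact hw ((Submodule.smul_mem_iff _ hc).1 huN)
    apply cases_T i j
    · rintro rfl
      rw [T_diag] at hu
      exact aux _ (Φ.e_not_mem_N i) hu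
    · intro h
      rw [T_thick i j h] at hu
      exact (hD i j h).X_inf u hu huN
    · intro hij h hl
      rw [T_thin i j hij h hl] at hu
      exact aux _ (hpN i j hij hl) hu
    · intro hij hl
      rwa [T_bot i j hij hl, Submodule.mem_bot] at hu
  · intro i j
    apply cases_T i j
    · rintro rfl x hx
      rw [T_diag, ← add_sub_cancel (Φ.lam i x • Φ.e i) x]
      exact Submodule.add_mem_sup
        (Submodule.smul_mem _ _ (Submodule.mem_span_singleton_self _)) (Φ.sub_lam_smul_mem_N hx)
    · intro h
      rw [T_thick i j h]
      exact (hD i j h).X_sup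
    · intro hij h hl x hx
      rw [T_thin i j hij h hl]
      have : ∃ c : F, x - c • (a i * b j) ∈ Φ.N := by
        by_contra! hcon
        exact h (Φ.exists_octonion hij (hp i j hl) hx (hpN i j hij hl) hcon)
      obtain ⟨c, hc⟩ := this
      rw [← add_sub_cancel (c • (a i * b j)) x]
      exact Submodule.add_mem_sup
        (Submodule.smul_mem _ _ (Submodule.mem_span_singleton_self _)) hc
    · intro hij hl x hx
      refine Submodule.mem_sup_right ?_
      by_contra hxN
      exact hl (Φ.linked_of_not_mem_N hij hx hxN)

theorem exists_principal_subalgebra : ∃ S : NonUnitalSubalgebra F U,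
    (∀ i, Φ.e i ∈ S) ∧ S.toSubmodule ⊓ Φ.N = ⊥ ∧ S.toSubmodule ⊔ Φ.N = ⊤ := by
  obtain ⟨T, hP, he, h1, h3, hN, hsup⟩ := Φ.exists_principal_components
  have hT : ∀ i j, T i j ≤ ⨆ ij : ι × ι, T ij.1 ij.2 := fun i j =>
    le_iSup (fun ij : ι × ι => T ij.1 ij.2) (i, j)
  have hmul : ∀ x ∈ ⨆ ij : ι × ι, T ij.1 ij.2, ∀ y ∈ ⨆ ij : ι × ι, T ij.1 ij.2,
      x * y ∈ ⨆ ij : ι × ι, T ij.1 ij.2 := by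
    intro x hx y hy
    induction hx using Submodule.iSup_induction' with
    | zero => rw [zero_mul]; exact Submodule.zero_mem _
    | add x x' _ _ hx hx' => rw [add_mul]; exact add_mem hx hx'
    | mem ij x hx =>
      induction hy using Submodule.iSup_induction' with
      | zero => rw [mul_zero]; exact Submodule.zero_mem _
      | add y y' _ _ hy hy' => rw [mul_add]; exact add_mem hy hy'
      | mem kl y hy =>
        obtain ⟨i, j⟩ := ij
        obtain ⟨k, l⟩ := kl
        by_cases hjk : j = k
        · subst hjk; exact hT i l (h1 _ _ _ x hx y hy)
        · by_cases hh : i = k ∧ j = l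
          · obtain ⟨rfl, rfl⟩ := hh
            exact hT j i (h3 _ _ (Ne.symm hjk) x hx y hy)
          · rw [Φ.mul_eq_zero (hP _ _ hx) (hP _ _ hy) hjk hh]; exact Submodule.zero_mem _
  refine ⟨{ (⨆ ij : ι × ι, T ij.1 ij.2 : Submodule F U) with
    mul_mem' := fun {x y} hx hy => hmul x hx y hy }, fun i => hT i i (he i), ?_, ?_⟩
  · rw [Submodule.eq_bot_iff]
    rintro x ⟨hx, hxN⟩
    have hproj : ∀ i j, (Φ.e i * x) * Φ.e j ∈ T i j := by
      intro i j
      clear hxN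
      induction hx using Submodule.iSup_induction' with
      | zero => simp
      | add x x' _ _ hx hx' => rw [mul_add, add_mul]; exact add_mem hx hx'
      | mem kl x hx =>
        rw [Φ.e_mul (hP _ _ hx)]
        split_ifs with hi
        · rw [Φ.mul_e (hP _ _ hx)]
          split_ifs with hj
          · rw [hi, hj]; exact hx
          · exact Submodule.zero_mem _
        · rw [zero_mul]; exact Submodule.zero_mem _
    rw [← Φ.sum_proj x]
    exact Finset.sum_eq_zero fun i _ => Finset.sum_eq_zero fun j _ =>
      hN _ _ _ (hproj i j) (Φ.mul_right_mem_N (Φ.mul_left_mem_N hxN _) _)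
  · rw [eq_top_iff]
    rintro x -
    refine Φ.induction (p := fun x => x ∈ _) (Submodule.zero_mem _)
      (fun _ _ => add_mem) (fun i j x hx => ?_) x
    exact sup_le_sup_right (hT i j) _ (hsup i j hx)

end Frame

end WedderburnPrincipal

section Engel

open LinearMap

variable {F : Type*} [Field F] {U : Type*} [NonUnitalNonAssocRing U] [Module F U]

/-- Multiplication by elements of `C` on either side maps `P` into `Q`. -/
def MulMapsInto (C P Q : Submodule F U) : Prop :=
  ∀ c ∈ C, ∀ m ∈ P, c * m ∈ Q ∧ m * c ∈ Q

theorem MulMapsInto.mono {C C' P P' Q Q' : Submodule F U} (h : MulMapsInto C P Q) (hC : C' ≤ C)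
    (hP : P' ≤ P) (hQ : Q ≤ Q') : MulMapsInto C' P' Q' :=
  fun c hc m hm => ⟨hQ (h c (hC hc) m (hP hm)).1, hQ (h c (hC hc) m (hP hm)).2⟩

/-- A nilpotent endomorphism moves any vector outside `Q` to a last one outside `Q`. -/
theorem exists_not_mem_apply_mem {f : Module.End F U} (hf : IsNilpotent f) (Q : Submodule F U)
    (p : U → Prop) (hp : ∀ x, p x → p (f x)) {m : U} (hm : p m) (hmQ : m ∉ Q) :
    ∃ m', p m' ∧ m' ∉ Q ∧ f m' ∈ Q := by
  by_contra! hcon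
  obtain ⟨n, hn⟩ := hf
  have h1 : ∀ k : ℕ, p ((f ^ k) m) ∧ (f ^ k) m ∉ Q := by
    intro k
    induction k with
    | zero => exact ⟨hm, hmQ⟩
    | succ k ih =>
      rw [pow_succ', Module.End.mul_apply]
      exact ⟨hp _ ih.1, hcon _ ih.1 ih.2⟩
  refine (h1 n).2 ?_
  rw [hn]
  exact Q.zero_mem

variable [SMulCommClass F U U] [IsScalarTower F U U]

namespace IsAlternative

variable (h : IsAlternative U)
include h

omit [SMulCommClass F U U] [IsScalarTower F U U] in
/-- The elements of `P` multiplied into `Q` by `D` are stable under normalizers of `D`. -/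
theorem mulMapsInto_singleton_stable {D Q : Submodule F U} {b m : U}
    (hbD : ∀ d ∈ D, b * d ∈ D ∧ d * b ∈ D) (hbQ : ∀ q ∈ Q, b * q ∈ Q ∧ q * b ∈ Q)
    (hm : ∀ d ∈ D, d * m ∈ Q ∧ m * d ∈ Q) :
    ∀ d ∈ D, (d * (b * m) ∈ Q ∧ (b * m) * d ∈ Q) ∧ (d * (m * b) ∈ Q ∧ (m * b) * d ∈ Q) := by
  intro d hd
  have h1 : d * (b * m) ∈ Q := by
    rw [eq_sub_of_add_eq (h.left_lin d b m).symm]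
    exact sub_mem (add_mem (hm _ (hbD d hd).2).1 (hm _ (hbD d hd).1).1) (hbQ _ (hm d hd).1).1
  have h2 : (m * b) * d ∈ Q := by
    rw [eq_sub_of_add_eq (h.right_lin b d m)]
    exact sub_mem (add_mem (hm _ (hbD d hd).1).2 (hm _ (hbD d hd).2).2) (hbQ _ (hm d hd).2).2
  refine ⟨⟨h1, ?_⟩, ?_, h2⟩
  · have h3 := h.associator_rotate d b m
    rw [associator, associator, sub_eq_iff_eq_add] at h3
    rw [h3]
    exact add_mem (sub_mem (hm _ (hbD d hd).2).1 h1) (hbQ _ (hm d hd).2).1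
  · have h3 := h.associator_rotate d m b
    rw [associator, associator, eq_comm, sub_eq_iff_eq_add, ← sub_eq_iff_eq_add'] at h3
    rw [← h3]
    exact sub_mem (hbQ _ (hm d hd).1).2 (sub_mem h2 (hm _ (hbD d hd).1).2)

/-- An Engel type theorem: a multiplicatively closed space of nilpotent elements acting on a
nonzero quotient `P / Q` annihilates a nonzero vector. -/
theorem exists_mulMapsInto [FiniteDimensional F U] (C : Submodule F U)
    (hC : ∀ x ∈ C, ∀ y ∈ C, x * y ∈ C) (hnil : ∀ x ∈ C, IsNilElem x) :
    ∀ Q P : Submodule F U, Q < P → MulMapsInto C P P → MulMapsInto C Q Q →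
      ∃ m ∈ P, m ∉ Q ∧ ∀ c ∈ C, c * m ∈ Q ∧ m * c ∈ Q := by
  induction C using WellFoundedLT.induction with
  | ind C ih =>
  intro Q P hQP hP hQ
  by_cases hbot : C = ⊥
  · obtain ⟨m, hm, hmQ⟩ := SetLike.exists_of_lt hQP
    refine ⟨m, hm, hmQ, fun c hc => ?_⟩
    rw [hbot, Submodule.mem_bot] at hc
    rw [hc, zero_mul, mul_zero]
    exact ⟨Q.zero_mem, Q.zero_mem⟩
  obtain ⟨D, ⟨hDC, hDmul⟩, hDmax⟩ := WellFounded.has_min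
    (wellFounded_gt : WellFounded (fun D D' : Submodule F U => D > D'))
    {D | D < C ∧ ∀ x ∈ D, ∀ y ∈ D, x * y ∈ D}
    ⟨⊥, bot_lt_iff_ne_bot.2 hbot, fun x hx y _ => by
      rw [(Submodule.mem_bot F).1 hx, zero_mul]; exact Submodule.zero_mem _⟩
  have ihD := ih D hDC hDmul fun x hx => hnil x (hDC.le hx)
  obtain ⟨b₀, hb₀C, hb₀D, hb₀⟩ := ihD D C hDC
    (fun d hd c hc => ⟨hC _ (hDC.le hd) _ hc, hC _ hc _ (hDC.le hd)⟩)
    (fun d hd c hc => ⟨hDmul _ hd _ hc, hDmul _ hc _ hd⟩)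
  obtain ⟨b, hbD, hbC, hbb, hbn⟩ : ∃ b, b ∉ D ∧ b ∈ C ∧ b * b ∈ D ∧
      ∀ d ∈ D, b * d ∈ D ∧ d * b ∈ D := by
    obtain ⟨b, ⟨n, rfl⟩, hbD, hbb⟩ := exists_not_mem_apply_mem
      (h.isNilpotent_mulLeft (F := F) (hnil b₀ hb₀C)) D (fun x => ∃ n, x = lpow b₀ n)
      (by rintro _ ⟨n, rfl⟩; exact ⟨n + 1, rfl⟩) ⟨0, rfl⟩ hb₀D
    have hl : ∀ k : ℕ, ∀ d ∈ D, (mulLeft F b₀ ^ k) d ∈ D := by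
      intro k
      induction k with
      | zero => exact fun d hd => hd
      | succ k ihk =>
        intro d hd
        rw [pow_succ, Module.End.mul_apply]
        exact ihk _ (hb₀ d hd).2
    have hr : ∀ k : ℕ, ∀ d ∈ D, (mulRight F b₀ ^ k) d ∈ D := by
      intro k
      induction k with
      | zero => exact fun d hd => hd
      | succ k ihk =>
        intro d hd
        rw [pow_succ, Module.End.mul_apply]
        exact ihk _ (hb₀ d hd).1
    refine ⟨lpow b₀ n, hbD, ?_, ?_, fun d hd => ⟨?_, ?_⟩⟩
    · clear hbD hbb
      induction n with
      | zero => exact hb₀C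
      | succ n ihn => exact hC _ hb₀C _ ihn
    · rw [← mulLeft_apply (R := F) (lpow b₀ n), h.mulLeft_lpow, pow_succ, Module.End.mul_apply]
      exact hl _ _ hbb
    · rw [← mulLeft_apply (R := F) (lpow b₀ n), h.mulLeft_lpow]
      exact hl _ d hd
    · rw [← mulRight_apply (R := F) (lpow b₀ n), h.mulRight_lpow]
      exact hr _ d hd
  have hDb : D ⊔ Submodule.span F {b} = C := by
    have hle : D ⊔ Submodule.span F {b} ≤ C :=
      sup_le hDC.le ((Submodule.span_singleton_le_iff_mem _ _).2 hbC)
    refine hle.eq_of_not_lt fun hlt => hDmax (D ⊔ Submodule.span F {b}) ⟨hlt, ?_⟩ ?_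
    · intro x hx y hy
      obtain ⟨d, hd, z, hz, rfl⟩ := Submodule.mem_sup.1 hx
      obtain ⟨d', hd', z', hz', rfl⟩ := Submodule.mem_sup.1 hy
      obtain ⟨c, rfl⟩ := Submodule.mem_span_singleton.1 hz
      obtain ⟨c', rfl⟩ := Submodule.mem_span_singleton.1 hz'
      refine Submodule.mem_sup_left ?_
      rw [add_mul, mul_add, mul_add, smul_mul_smul_comm, mul_smul_comm, smul_mul_assoc]
      exact add_mem (add_mem (hDmul _ hd _ hd') (D.smul_mem _ (hbn d hd).2))
        (add_mem (D.smul_mem _ (hbn d' hd').1) (D.smul_mem _ hbb))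
    · exact lt_of_le_of_ne le_sup_left fun heq => hbD (by
        rw [heq]
        exact Submodule.mem_sup_right (Submodule.mem_span_singleton_self b))
  obtain ⟨m₀, hm₀P, hm₀Q, hm₀⟩ := ihD Q P hQP (hP.mono hDC.le le_rfl le_rfl)
    (hQ.mono hDC.le le_rfl le_rfl)
  have hbQ : ∀ q ∈ Q, b * q ∈ Q ∧ q * b ∈ Q := fun q hq => hQ b hbC q hq
  have key := fun m => h.mulMapsInto_singleton_stable (Q := Q) (m := m) hbn hbQ
  obtain ⟨m₁, ⟨hm₁P, hm₁⟩, hm₁Q, hbm₁⟩ := exists_not_mem_apply_mem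
    (h.isNilpotent_mulLeft (F := F) (hnil b hbC)) Q
    (fun m => m ∈ P ∧ ∀ d ∈ D, d * m ∈ Q ∧ m * d ∈ Q)
    (fun m hm => ⟨(hP b hbC m hm.1).1, fun d hd => (key m hm.2 d hd).1⟩) ⟨hm₀P, hm₀⟩ hm₀Q
  obtain ⟨m, ⟨hmP, hm, hbm⟩, hmQ, hmb⟩ := exists_not_mem_apply_mem
    (h.isNilpotent_mulRight (F := F) (hnil b hbC)) Q
    (fun m => m ∈ P ∧ (∀ d ∈ D, d * m ∈ Q ∧ m * d ∈ Q) ∧ b * m ∈ Q)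
    (fun m hm => ⟨(hP b hbC m hm.1).2, fun d hd => (key m hm.2.1 d hd).2, by
      rw [mulRight_apply, ← h.flexible]
      exact (hbQ _ hm.2.2).2⟩) ⟨hm₁P, hm₁, hbm₁⟩ hm₁Q
  refine ⟨m, hmP, hmQ, fun c hc => ?_⟩
  rw [← hDb] at hc
  obtain ⟨d, hd, z, hz, rfl⟩ := Submodule.mem_sup.1 hc
  obtain ⟨t, rfl⟩ := Submodule.mem_span_singleton.1 hz
  rw [add_mul, mul_add, smul_mul_assoc, mul_smul_comm]
  exact ⟨add_mem (hm d hd).1 (Q.smul_mem _ hbm), add_mem (hm d hd).2 (Q.smul_mem _ hmb)⟩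

end IsAlternative

end Engel

section BRadical

variable {F : Type*} [Field F] {U : Type*} [NonUnitalNonAssocRing U] [Module F U]

/-- A subspace is a two-sided ideal. -/
def IsMulIdeal (J : Submodule F U) : Prop := ∀ x ∈ J, ∀ u : U, u * x ∈ J ∧ x * u ∈ J

/-- `J` is maximal among the ideals strictly contained in the kernel of `ω`. -/
def IsMaximalBarIdeal (ω : U →ₗ[F] F) (J : Submodule F U) : Prop :=
  Maximal (fun J => IsMulIdeal J ∧ J < LinearMap.ker ω) J

theorem IsMulIdeal.inf {J K : Submodule F U} (hJ : IsMulIdeal J) (hK : IsMulIdeal K) :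
    IsMulIdeal (J ⊓ K) :=
  fun x hx u => ⟨⟨(hJ x hx.1 u).1, (hK x hx.2 u).1⟩, ⟨(hJ x hx.1 u).2, (hK x hx.2 u).2⟩⟩

theorem IsMulIdeal.sInf {s : Set (Submodule F U)} (hs : ∀ J ∈ s, IsMulIdeal J) :
    IsMulIdeal (sInf s) := by
  intro x hx u
  rw [Submodule.mem_sInf] at hx
  exact ⟨(Submodule.mem_sInf).2 fun J hJ => (hs J hJ x (hx J hJ) u).1,
    (Submodule.mem_sInf).2 fun J hJ => (hs J hJ x (hx J hJ) u).2⟩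

theorem isMulIdeal_ker {ω : U →ₗ[F] F} (hω : ∀ x y, ω (x * y) = ω x * ω y) :
    IsMulIdeal (LinearMap.ker ω) := by
  intro x hx u
  rw [LinearMap.mem_ker] at hx
  simp [hω, hx]

theorem IsMulIdeal.exists_maximalBarIdeal [FiniteDimensional F U] {ω : U →ₗ[F] F}
    {K : Submodule F U} (hK : IsMulIdeal K) (hlt : K < LinearMap.ker ω) :
    ∃ J, IsMaximalBarIdeal ω J ∧ K ≤ J := by
  obtain ⟨J, ⟨hJ, hKJ⟩, hmax⟩ := WellFounded.has_min
    (wellFounded_gt : WellFounded (fun D D' : Submodule F U => D > D'))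
    {J | (IsMulIdeal J ∧ J < LinearMap.ker ω) ∧ K ≤ J} ⟨K, ⟨hK, hlt⟩, le_rfl⟩
  refine ⟨J, ⟨hJ, fun J' hJ' hle => ?_⟩, hKJ⟩
  by_contra hcon
  exact hmax J' ⟨hJ', hKJ.trans hle⟩ (lt_of_le_not_ge hle hcon)

/-- The intersection of the maximal ideals inside the kernel of `ω`. -/
def bRadIdeal (ω : U →ₗ[F] F) : Submodule F U :=
  LinearMap.ker ω ⊓ sInf {J | IsMaximalBarIdeal ω J}

theorem isMulIdeal_bRadIdeal {ω : U →ₗ[F] F} (hω : ∀ x y, ω (x * y) = ω x * ω y) :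
    IsMulIdeal (bRadIdeal ω) :=
  (isMulIdeal_ker hω).inf (IsMulIdeal.sInf fun _ hJ => (Set.mem_ofPred_eq.le hJ).prop.1)

variable [SMulCommClass F U U] [IsScalarTower F U U]

/-- The subalgebra spanned by an ideal `J` and an element of weight one that is idempotent
modulo `J`. -/
def IsMulIdeal.adjoin {J : Submodule F U} (hJ : IsMulIdeal J) {ω : U →ₗ[F] F}
    (hω : ∀ x y, ω (x * y) = ω x * ω y) {b : U} (hb : b * b - b ∈ J) :
    NonUnitalSubalgebra F U where
  carrier := {x | x - ω x • b ∈ J}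
  zero_mem' := by simp
  add_mem' {x y} hx hy := by
    rw [Set.mem_ofPred_eq] at hx hy
    have := add_mem hx hy
    simp only [Set.mem_ofPred_eq, map_add, add_smul]
    rwa [add_sub_add_comm]
  smul_mem' c x hx := by
    have := J.smul_mem c hx
    simp only [Set.mem_ofPred_eq, map_smul, smul_eq_mul, mul_smul]
    rwa [← smul_sub]
  mul_mem' {x y} hx hy := by
    rw [Set.mem_ofPred_eq] at hx hy
    have h1 : x * y - ω (x * y) • b = (x - ω x • b) * y +
        ω x • (b * (y - ω y • b)) + (ω x * ω y) • (b * b - b) := by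
      rw [hω, sub_mul, mul_sub, smul_sub, smul_sub, smul_mul_assoc, mul_smul_comm, smul_smul]
      abel
    simp only [Set.mem_ofPred_eq]
    rw [h1]
    exact add_mem (add_mem (hJ _ hx y).2 (J.smul_mem _ (hJ _ hy b).1)) (J.smul_mem _ hb)

section Adjoin

variable {J : Submodule F U} (hJ : IsMulIdeal J) {ω : U →ₗ[F] F}
  (hω : ∀ x y, ω (x * y) = ω x * ω y) {b : U} (hb : b * b - b ∈ J)

theorem IsMulIdeal.mem_adjoin {x : U} : x ∈ hJ.adjoin hω hb ↔ x - ω x • b ∈ J := Iff.rfl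

theorem IsMulIdeal.barSet_adjoin (hle : J ≤ LinearMap.ker ω) :
    barSet F U ω (hJ.adjoin hω hb) = J := by
  ext x
  simp only [barSet, Set.mem_ofPred_eq, mem_adjoin, SetLike.mem_coe]
  constructor
  · rintro ⟨h1, h2⟩
    rwa [h2, zero_smul, sub_zero] at h1
  · intro hx
    have h2 : ω x = 0 := hle hx
    rw [h2, zero_smul, sub_zero]
    exact ⟨hx, rfl⟩

theorem IsMulIdeal.isNormal_adjoin (hle : J ≤ LinearMap.ker ω) (hb1 : ω b = 1) :
    IsNormalBSubalgebra F U ω (hJ.adjoin hω hb) := by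
  refine ⟨⟨b, ?_, by rw [hb1]; exact one_ne_zero⟩, ?_⟩
  · rw [hJ.mem_adjoin hω hb, hb1, one_smul, sub_self]
    exact J.zero_mem
  · rw [hJ.barSet_adjoin hω hb hle]
    exact hJ

end Adjoin

/-- The bar set of a subalgebra as a submodule. -/
def barSubmodule (ω : U →ₗ[F] F) (B : NonUnitalSubalgebra F U) : Submodule F U :=
  B.toSubmodule ⊓ LinearMap.ker ω

omit [SMulCommClass F U U] [IsScalarTower F U U] in
theorem coe_barSubmodule (ω : U →ₗ[F] F) (B : NonUnitalSubalgebra F U) :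
    (barSubmodule ω B : Set U) = barSet F U ω B := rfl

theorem coe_bRadIdeal {ω : U →ₗ[F] F} (hω : ∀ x y, ω (x * y) = ω x * ω y) {e : U}
    (he : e * e = e) (he1 : ω e = 1) : (bRadIdeal ω : Set U) = bRad F U ω := by
  have hemem : ∀ J : Submodule F U, e * e - e ∈ J := fun J => by
    rw [he, sub_self]; exact J.zero_mem
  ext x
  simp only [SetLike.mem_coe, bRadIdeal, Submodule.mem_inf, Submodule.mem_sInf,
    Set.mem_ofPred_eq, bRad]
  split_ifs with hsimple
  · have hideal : ∀ J : Submodule F U, IsMulIdeal J → J < LinearMap.ker ω → J = ⊥ := by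
      intro J hJ hlt
      have h1 := hJ.barSet_adjoin hω (hemem J) hlt.le
      rcases hsimple _ (hJ.isNormal_adjoin hω (hemem J) hlt.le he1) with h3 | h3
      · rw [h1] at h3
        exact SetLike.coe_injective h3
      · rw [h1] at h3
        exact absurd (SetLike.coe_injective h3) hlt.ne
    constructor
    · rintro ⟨hx, hall⟩
      by_cases hk : LinearMap.ker ω = ⊥
      · rw [hk] at hx
        exact hx
      · have hbot : IsMulIdeal (⊥ : Submodule F U) := fun x hx u => by
          rw [(Submodule.mem_bot F).1 hx, mul_zero, zero_mul]
          exact ⟨Submodule.zero_mem _, Submodule.zero_mem _⟩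
        exact hall ⊥ ⟨⟨hbot, bot_lt_iff_ne_bot.2 hk⟩, fun J hJ _ => (hideal J hJ.1 hJ.2).le⟩
    · rintro rfl
      exact ⟨Submodule.zero_mem _, fun J _ => J.zero_mem⟩
  · rw [Set.mem_iInter₂]
    constructor
    · rintro ⟨hx, hall⟩ B ⟨⟨⟨b₀, hb₀, hbω⟩, hnorm⟩, hmax⟩
      rw [← coe_barSubmodule] at hnorm ⊢
      have hI : IsMulIdeal (barSubmodule ω B) := hnorm
      rcases eq_or_lt_of_le (show barSubmodule ω B ≤ LinearMap.ker ω from inf_le_right) with heq | hlt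
      · rw [SetLike.mem_coe, heq]
        exact hx
      refine hall _ ⟨⟨hI, hlt⟩, fun J hJ hle => ?_⟩
      by_contra hcon
      obtain ⟨b, hb, hb1⟩ : ∃ b ∈ B, ω b = 1 :=
        ⟨(ω b₀)⁻¹ • b₀, B.smul_mem' _ hb₀, by simp [hbω]⟩
      have hbb : b * b - b ∈ J := hle ⟨sub_mem (B.mul_mem' hb hb) hb, by simp [hω, hb1]⟩
      refine hmax ⟨hJ.1.adjoin hω hbb, hJ.1.isNormal_adjoin hω hbb hJ.2.le hb1, ?_, ?_⟩
      · refine lt_of_le_not_ge (fun y hy => ?_) fun hge => hcon fun z hz => ?_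
        · rw [hJ.1.mem_adjoin hω hbb]
          exact hle ⟨sub_mem hy (B.smul_mem' _ hb), by simp [hb1]⟩
        · have hz0 : ω z = 0 := hJ.2.le hz
          refine ⟨hge ?_, hz0⟩
          rw [hJ.1.mem_adjoin hω hbb, hz0, zero_smul, sub_zero]
          exact hz
      · refine lt_of_le_not_ge le_top fun hge => hJ.2.not_ge fun z hz => ?_
        have := hge (NonUnitalAlgebra.mem_top (R := F) (x := z))
        rwa [hJ.1.mem_adjoin hω hbb, LinearMap.mem_ker.1 hz, zero_smul, sub_zero] at this
    · intro hall
      refine ⟨?_, fun J hJ => ?_⟩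
      · refine (hall ⊤ ⟨⟨⟨e, NonUnitalAlgebra.mem_top, by rw [he1]; exact one_ne_zero⟩, ?_⟩, ?_⟩).2
        · rintro y ⟨-, hy⟩ u
          exact ⟨⟨NonUnitalAlgebra.mem_top, by rw [hω, hy, mul_zero]⟩,
            ⟨NonUnitalAlgebra.mem_top, by rw [hω, hy, zero_mul]⟩⟩
        · rintro ⟨C, -, h1, h3⟩
          exact lt_asymm h1 h3
      · have hle := hJ.prop.2.le
        have hmem : ∀ y, y ∈ hJ.prop.1.adjoin hω (hemem J) ↔ y - ω y • e ∈ J :=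
          fun y => hJ.prop.1.mem_adjoin hω (hemem J)
        rw [← SetLike.mem_coe, ← hJ.prop.1.barSet_adjoin hω (hemem J) hle]
        refine hall _ ⟨hJ.prop.1.isNormal_adjoin hω (hemem J) hle he1, ?_⟩
        rintro ⟨C, ⟨-, hC⟩, hlt, htop⟩
        rw [← coe_barSubmodule] at hC
        have hCI : IsMulIdeal (barSubmodule ω C) := hC
        have heC : e ∈ C := hlt.le (by
          rw [hmem, he1, one_smul, sub_self]; exact J.zero_mem)
        have hJC : J ≤ barSubmodule ω C := fun z hz => by
          have hz0 : ω z = 0 := hle hz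
          refine ⟨hlt.le ?_, hz0⟩
          rw [hmem, hz0, zero_smul, sub_zero]
          exact hz
        have hmemC : ∀ y, y - ω y • e ∈ barSubmodule ω C ↔ y ∈ C := by
          intro y
          constructor
          · intro hy
            have := add_mem hy.1 (C.smul_mem' (ω y) heC)
            rwa [sub_add_cancel] at this
          · intro hy
            exact ⟨sub_mem hy (C.smul_mem' _ heC), by simp [he1]⟩
        rcases eq_or_lt_of_le (show barSubmodule ω C ≤ LinearMap.ker ω from inf_le_right) with heq | hlt'
        · refine htop.not_ge fun y _ => (hmemC y).1 ?_
          rw [heq]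
          simp [he1]
        · refine hlt.not_ge fun y hy => ?_
          rw [hmem]
          exact hJ.le_of_ge ⟨hCI, hlt'⟩ hJC ((hmemC y).2 hy)

/-- The b-radical lies in the radical of an associative trace form `τ`, provided the latter
contains every ideal that squares into it. -/
theorem bRadIdeal_le_of_trace [FiniteDimensional F U] {ω : U →ₗ[F] F}
    (hω : ∀ x y, ω (x * y) = ω x * ω y) (τ : U →ₗ[F] F)
    (hcomm : ∀ x y, τ (x * y) = τ (y * x)) (hassoc : ∀ x y z, τ ((x * y) * z) = τ (x * (y * z)))
    (N : Submodule F U) (hN : ∀ x, x ∈ N ↔ ∀ y, τ (x * y) = 0)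
    (hNil : ∀ Z : Submodule F U, IsMulIdeal Z → (∀ z ∈ Z, z * z ∈ N) → Z ≤ N) :
    bRadIdeal ω ≤ N := by
  set R := bRadIdeal ω with hR
  have hRI : IsMulIdeal R := isMulIdeal_bRadIdeal hω
  let β : LinearMap.BilinForm F U := (LinearMap.mul F U).compr₂ τ
  have hβ : ∀ x y, β x y = τ (x * y) := fun x y => rfl
  have hO : ∀ y, y ∈ β.orthogonal R ↔ ∀ r ∈ R, τ (r * y) = 0 := fun y => Iff.rfl
  have hOI : IsMulIdeal (β.orthogonal R) := by
    intro y hy u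
    rw [hO] at hy
    constructor
    · rw [hO]
      intro r hr
      rw [← hassoc]
      exact hy _ (hRI r hr u).2
    · rw [hO]
      intro r hr
      rw [← hassoc, hcomm, ← hassoc]
      exact hy _ (hRI r hr u).1
  have hinf : R ⊓ β.orthogonal R ≤ N := by
    refine hNil _ (hRI.inf hOI) fun z hz => (hN _).2 fun u => ?_
    rw [hassoc]
    exact (hO _).1 (hOI z hz.2 u).2 z hz.1
  have hker : LinearMap.ker β = N := by
    ext x
    rw [LinearMap.mem_ker, hN]
    exact ⟨fun hx y => by rw [← hβ, hx]; rfl, fun hx => LinearMap.ext fun y => hx y⟩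
  have hsup : R ⊔ β.orthogonal R = ⊤ := by
    apply Submodule.eq_top_of_finrank_eq
    have h1 := LinearMap.BilinForm.finrank_add_finrank_orthogonal' (B := β) R
    have h3 := Submodule.finrank_sup_add_finrank_inf_eq R (β.orthogonal R)
    have h4 : Module.finrank F ↥(R ⊓ β.orthogonal R) ≤
        Module.finrank F ↥(R ⊓ LinearMap.ker β) :=
      Submodule.finrank_mono (le_inf inf_le_left (hinf.trans hker.ge))
    have h5 := Submodule.finrank_le (R ⊔ β.orthogonal R)
    omega
  have hRle : R ≤ LinearMap.ker ω := inf_le_left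
  have hsup' : R ⊔ β.orthogonal R ⊓ LinearMap.ker ω = LinearMap.ker ω := by
    rw [← sup_inf_assoc_of_le _ hRle, hsup, top_inf_eq]
  rcases eq_or_lt_of_le (inf_le_right : β.orthogonal R ⊓ LinearMap.ker ω ≤ LinearMap.ker ω)
    with heq | hlt
  · exact (le_inf le_rfl (hRle.trans (inf_eq_right.1 heq))).trans hinf
  · obtain ⟨J, hJ, hle⟩ := (hOI.inf (isMulIdeal_ker hω)).exists_maximalBarIdeal hlt
    have hRJ : R ≤ J := inf_le_right.trans (sInf_le hJ)
    exact absurd (hsup'.ge.trans (sup_le hRJ hle)) hJ.prop.2.not_ge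

/-- Products of a nil ideal of weight zero lie in the b-radical. -/
theorem IsAlternative.mul_mem_bRadIdeal [FiniteDimensional F U] (h : IsAlternative U)
    {ω : U →ₗ[F] F} (hω : ∀ x y, ω (x * y) = ω x * ω y) {N : Submodule F U}
    (hN : IsMulIdeal N) (hle : N ≤ LinearMap.ker ω) (hnil : ∀ x ∈ N, IsNilElem x) {x y : U}
    (hx : x ∈ N) (hy : y ∈ N) : x * y ∈ bRadIdeal ω := by
  refine ⟨hle (hN x hx y).2, (Submodule.mem_sInf).2 fun J hJ => ?_⟩
  rw [Set.mem_ofPred_eq] at hJ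
  obtain ⟨m, hm, hmJ, hmN⟩ := h.exists_mulMapsInto N (fun x _ y hy => (hN y hy x).1) hnil J
    (LinearMap.ker ω) hJ.prop.2 (fun c _ m hm => isMulIdeal_ker hω m hm c)
    (fun c _ m hm => hJ.prop.1 m hm c)
  let K : Submodule F U :=
    { carrier := {m | ω m = 0 ∧ ∀ c ∈ N, c * m ∈ J ∧ m * c ∈ J}
      zero_mem' := ⟨map_zero ω, fun c _ => by rw [mul_zero, zero_mul]; exact ⟨J.zero_mem, J.zero_mem⟩⟩
      add_mem' := fun {a b} ha hb => ⟨by rw [map_add, ha.1, hb.1, add_zero], fun c hc => by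
        rw [mul_add, add_mul]
        exact ⟨add_mem (ha.2 c hc).1 (hb.2 c hc).1, add_mem (ha.2 c hc).2 (hb.2 c hc).2⟩⟩
      smul_mem' := fun t a ha => ⟨by rw [map_smul, ha.1, smul_zero], fun c hc => by
        rw [mul_smul_comm, smul_mul_assoc]
        exact ⟨J.smul_mem t (ha.2 c hc).1, J.smul_mem t (ha.2 c hc).2⟩⟩ }
  have hKI : IsMulIdeal K := by
    intro a ha u
    have hst := h.mulMapsInto_singleton_stable (D := N) (Q := J) (b := u) (m := a)
      (fun d hd => hN d hd u) (fun q hq => hJ.prop.1 q hq u) ha.2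
    exact ⟨⟨by rw [hω, ha.1, mul_zero], fun c hc => (hst c hc).1⟩,
      ⟨by rw [hω, ha.1, zero_mul], fun c hc => (hst c hc).2⟩⟩
  have hKle : K ≤ LinearMap.ker ω := fun a ha => ha.1
  have hJK : J ≤ K := fun a ha => ⟨hJ.prop.2.le ha, fun c _ => hJ.prop.1 a ha c⟩
  rcases eq_or_lt_of_le hKle with heq | hlt
  · have hyK : y ∈ K := by rw [heq]; exact hle hy
    exact (hyK.2 x hx).1
  · exact absurd (hJ.le_of_ge ⟨hKI, hlt⟩ hJK (⟨hm, hmN⟩ : m ∈ K)) hmJ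

end BRadical

section WeightedFrame

open LinearMap

variable {F : Type*} [Field F] {U : Type*} [NonAssocRing U] [Module F U]
  [SMulCommClass F U U] [IsScalarTower F U U]

include F in
theorem IsAlternative.isNilElem_of_mul_self (h : IsAlternative U) {z : U}
    (hz : IsNilElem (z * z)) : IsNilElem z := by
  refine IsAlternative.isNilElem_of_mulLeft (F := F) ?_
  have h1 := h.isNilpotent_mulLeft (F := F) hz
  rw [show z * z = lpow z 1 from rfl, h.mulLeft_lpow] at h1
  obtain ⟨k, hk⟩ := h1
  exact ⟨(1 + 1) * k, by rw [pow_mul, hk]⟩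

omit [SMulCommClass F U U] [IsScalarTower F U U] in
theorem apply_eq_zero_of_isNilElem {ω : U →ₗ[F] F} (hω : ∀ x y, ω (x * y) = ω x * ω y) {x : U}
    (hx : IsNilElem x) : ω x = 0 := by
  obtain ⟨n, hn⟩ := hx
  have h1 : ∀ k : ℕ, ω (lpow x k) = ω x ^ (k + 1) := by
    intro k
    induction k with
    | zero => simp [lpow]
    | succ k ih => rw [lpow, hω, ih, ← pow_succ']
  have h3 := h1 n
  rw [hn, map_zero] at h3
  exact pow_eq_zero_iff (Nat.succ_ne_zero n) |>.1 h3.symm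

namespace Frame

variable {ι : Type*} [Fintype ι] [DecidableEq ι] (Φ : Frame F U ι)

theorem isMulIdeal_N : IsMulIdeal Φ.N :=
  fun _ hx u => ⟨Φ.mul_left_mem_N hx u, Φ.mul_right_mem_N hx u⟩

theorem le_N_of_nil {S : NonUnitalSubalgebra F U} (he : ∀ i, Φ.e i ∈ S)
    (hsup : S.toSubmodule ⊔ Φ.N = ⊤) {Z : Submodule F U} (hnil : ∀ z ∈ Z, IsNilElem z)
    (hZ : ∀ z ∈ Z, ∀ s ∈ S, s * z ∈ Z ∧ z * s ∈ Z) : Z ≤ Φ.N := by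
  intro z hz
  rw [Φ.mem_N]
  intro u
  obtain ⟨s, hs, n, hn, rfl⟩ := Submodule.mem_sup.1 (hsup.ge (Submodule.mem_top (x := u)))
  rw [mul_add, map_add, Φ.tau_mul_comm z n, hn z, add_zero]
  exact Φ.tau_eq_zero_of_nil hnil (fun i z hz => (hZ z hz _ (he i)).1)
    (fun i z hz => (hZ z hz _ (he i)).2) (hZ z hz s hs).2

theorem bRadIdeal_le_N [IsAlgClosed F] [FiniteDimensional F U] {ω : U →ₗ[F] F}
    (hω : ∀ x y, ω (x * y) = ω x * ω y) : bRadIdeal ω ≤ Φ.N := by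
  refine bRadIdeal_le_of_trace hω Φ.tau Φ.tau_mul_comm Φ.tau_mul_assoc Φ.N (fun x => Φ.mem_N)
    fun Z hZ hzz => Φ.le_N_of_nil (S := ⊤) (fun i => NonUnitalAlgebra.mem_top) ?_
      (fun z hz => Φ.alt.isNilElem_of_mul_self (F := F) (Φ.isNilElem_of_mem_N (hzz z hz)))
      fun z hz s _ => hZ z hz s
  exact top_le_iff.1 fun x _ => Submodule.mem_sup_left (NonUnitalAlgebra.mem_top (R := F))

omit [DecidableEq ι] in
theorem exists_weight_one {ω : U →ₗ[F] F} (hω : ∀ x y, ω (x * y) = ω x * ω y) (hω0 : ω ≠ 0) :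
    ∃ i, ω (Φ.e i) = 1 := by
  obtain ⟨x, hx⟩ := DFunLike.ne_iff.1 hω0
  rw [LinearMap.zero_apply] at hx
  have h1 : ω 1 ≠ 0 := fun h1 => hx (by rw [← one_mul x, hω, h1, zero_mul])
  rw [← Φ.sum_one, map_sum] at h1
  obtain ⟨i, -, hi⟩ := Finset.exists_ne_zero_of_sum_ne_zero h1
  refine ⟨i, mul_left_cancel₀ hi ?_⟩
  rw [← hω, Φ.mul_self, mul_one]

section PrincipalSubalgebra

variable {S : NonUnitalSubalgebra F U} (he : ∀ i, Φ.e i ∈ S) (hinf : S.toSubmodule ⊓ Φ.N = ⊥)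
  (hsup : S.toSubmodule ⊔ Φ.N = ⊤) {ω : U →ₗ[F] F} (hω : ∀ x y, ω (x * y) = ω x * ω y)
  {i₀ : ι} (hi₀ : ω (Φ.e i₀) = 1)

include he hinf hsup hω hi₀

theorem isBSemisimpleSubalgebra [FiniteDimensional F U] : IsBSemisimpleSubalgebra F U ω S := by
  refine ⟨⟨_, he i₀, by rw [hi₀]; exact one_ne_zero⟩, ?_⟩
  have : FiniteDimensional F ↥S := inferInstanceAs (FiniteDimensional F ↥S.toSubmodule)
  have hωS : ∀ x y : ↥S, (ω.comp (subalgebraIncl F U S)) (x * y) =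
      (ω.comp (subalgebraIncl F U S)) x * (ω.comp (subalgebraIncl F U S)) y :=
    fun x y => hω x y
  have hle : bRadIdeal (ω.comp (subalgebraIncl F U S)) ≤ ⊥ := by
    refine bRadIdeal_le_of_trace hωS (Φ.tau.comp (subalgebraIncl F U S))
      (fun x y => Φ.tau_mul_comm x y) (fun x y z => Φ.tau_mul_assoc x y z) ⊥ ?_ ?_
    · intro x
      constructor
      · intro hx y
        rw [(Submodule.mem_bot F).1 hx, zero_mul, map_zero]
      · intro hx
        have hxN : (x : U) ∈ Φ.N := Φ.mem_N.2 fun u => by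
          obtain ⟨s, hs, n, hn, rfl⟩ :=
            Submodule.mem_sup.1 (hsup.ge (Submodule.mem_top (x := u)))
          rw [mul_add, map_add, Φ.tau_mul_comm _ n, hn, add_zero]
          exact hx ⟨s, hs⟩
        have hx0 : (x : U) ∈ S.toSubmodule ⊓ Φ.N := ⟨x.2, hxN⟩
        rw [hinf, Submodule.mem_bot] at hx0
        exact Subtype.ext hx0
    · intro Z hZ hzz z hz
      have h1 : Z.map (subalgebraIncl F U S) ≤ Φ.N := by
        refine Φ.le_N_of_nil he hsup ?_ ?_
        · rintro _ ⟨w, hw, rfl⟩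
          refine Φ.alt.isNilElem_of_mul_self (F := F) ⟨0, ?_⟩
          exact congrArg Subtype.val ((Submodule.mem_bot F).1 (hzz w hw))
        · rintro _ ⟨w, hw, rfl⟩ s hs
          exact ⟨⟨_, (hZ w hw ⟨s, hs⟩).1, rfl⟩, ⟨_, (hZ w hw ⟨s, hs⟩).2, rfl⟩⟩
      have hz0 : (z : U) ∈ S.toSubmodule ⊓ Φ.N := ⟨z.2, h1 ⟨z, hz, rfl⟩⟩
      rw [hinf, Submodule.mem_bot] at hz0
      exact Subtype.ext hz0
  rw [← coe_bRadIdeal hωS (e := (⟨Φ.e i₀, he i₀⟩ : ↥S)) (Subtype.ext (Φ.mul_self i₀)) hi₀,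
    le_bot_iff.1 hle]
  rfl

omit he hinf hsup in
theorem mem_N_of_mem_P_weight {j : ι} (hj : j ≠ i₀) {x : U}
    (hx : x ∈ Φ.P i₀ j ∨ x ∈ Φ.P j i₀) : x ∈ Φ.N := by
  have hωj : ω (Φ.e j) = 0 := by
    have h1 := hω (Φ.e i₀) (Φ.e j)
    rwa [Φ.orth _ _ hj.symm, map_zero, hi₀, one_mul, eq_comm] at h1
  by_contra hxN
  rcases hx with hx | hx
  · obtain ⟨c, -, h1, h3⟩ := Φ.exists_inverse hj.symm hx hxN
    have := hω x c
    rw [mul_comm, ← hω, h1, h3, hi₀, hωj] at this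
    exact one_ne_zero this
  · obtain ⟨c, -, h1, h3⟩ := Φ.exists_inverse hj hx hxN
    have := hω x c
    rw [mul_comm, ← hω, h1, h3, hi₀, hωj] at this
    exact zero_ne_one this

omit hsup in
theorem weight_idempotent_mul_eq_zero {x : U} (hx : x ∈ S) (hx0 : ω x = 0) :
    Φ.e i₀ * x = 0 ∧ x * Φ.e i₀ = 0 := by
  have hzero : ∀ y ∈ S, y ∈ Φ.N → y = 0 := fun y hy hyN => by
    have h1 : y ∈ S.toSubmodule ⊓ Φ.N := ⟨hy, hyN⟩
    rwa [hinf, Submodule.mem_bot] at h1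
  have hcorner : (Φ.e i₀ * x) * Φ.e i₀ = 0 := by
    have hP := Φ.proj_mem i₀ i₀ x
    have h1 := hzero _ (sub_mem (S.mul_mem' (S.mul_mem' (he i₀) hx) (he i₀))
      (S.smul_mem' (Φ.lam i₀ ((Φ.e i₀ * x) * Φ.e i₀)) (he i₀))) (Φ.sub_lam_smul_mem_N hP)
    have h3 := congrArg ω h1
    rw [map_sub, map_smul, hω, hω, hi₀, hx0, map_zero, one_mul, zero_mul, smul_eq_mul, mul_one,
      zero_sub, neg_eq_zero] at h3
    rwa [h3, zero_smul, sub_zero] at h1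
  constructor
  · rw [← mul_one (Φ.e i₀ * x), ← Φ.sum_one, Finset.mul_sum]
    refine Finset.sum_eq_zero fun j _ => ?_
    rcases eq_or_ne j i₀ with rfl | hj
    · exact hcorner
    · exact hzero _ (S.mul_mem' (S.mul_mem' (he i₀) hx) (he j))
        (Φ.mem_N_of_mem_P_weight hω hi₀ hj (Or.inl (Φ.proj_mem i₀ j x)))
  · rw [← one_mul x, ← Φ.sum_one, Finset.sum_mul, Finset.sum_mul]
    refine Finset.sum_eq_zero fun j _ => ?_
    rcases eq_or_ne j i₀ with rfl | hj
    · exact hcorner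
    · exact hzero _ (S.mul_mem' (S.mul_mem' (he j) hx) (he i₀))
        (Φ.mem_N_of_mem_P_weight hω hi₀ hj (Or.inr (Φ.proj_mem j i₀ x)))

theorem eq_bot_of_nil_ideal_bar {I : Submodule F U} (hI : (I : Set U) ⊆ barSet F U ω S)
    (hmul : ∀ x ∈ I, ∀ y ∈ barSet F U ω S, x * y ∈ I ∧ y * x ∈ I)
    (hnil : ∀ x ∈ I, IsNilElem x) : I = ⊥ := by
  have h1 : I ≤ Φ.N := by
    refine Φ.le_N_of_nil he hsup hnil fun z hz s hs => ?_
    have hs' : s - ω s • Φ.e i₀ ∈ barSet F U ω S :=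
      ⟨sub_mem hs (S.smul_mem' _ (he i₀)), by simp [hi₀]⟩
    obtain ⟨h3, h4⟩ := hmul z hz _ hs'
    obtain ⟨h5, h6⟩ := Φ.weight_idempotent_mul_eq_zero he hinf hω hi₀ (hI hz).1 (hI hz).2
    rw [mul_sub, mul_smul_comm, h6, smul_zero, sub_zero] at h3
    rw [sub_mul, smul_mul_assoc, h5, smul_zero, sub_zero] at h4
    exact ⟨h4, h3⟩
  rw [← le_bot_iff, ← hinf]
  exact le_inf (fun x hx => (hI hx).1) h1

end PrincipalSubalgebra

end Frame

end WeightedFrame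

/-- Let `F` be an algebraically closed field of characteristic different from
2, 3 and 5 and let `(U, ω)` be a finite-dimensional b-alternative algebra over
`F` with unity element `1`.  Then `U = S ⊕ V ⊕ rad(U)` with `S` a b-semisimple
b-subalgebra, `V ⊆ bar(U)` with `V·V ⊆ rad(U)`; moreover `bar(S)` is a
semisimple algebra (its only nil two-sided ideal is zero) and `V ⊕ rad(U)` is a
nil two-sided ideal of `bar(U)`. -/
theorem wedderburn_b_decomposition_unital
    (F : Type*) [Field F] [IsAlgClosed F]
    (hchar : ringChar F ≠ 2 ∧ ringChar F ≠ 3 ∧ ringChar F ≠ 5)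
    (U : Type*) [NonAssocRing U] [Module F U]
    [SMulCommClass F U U] [IsScalarTower F U U] [FiniteDimensional F U]
    (halt : ∀ x y : U, (x * x) * y = x * (x * y) ∧ (y * x) * x = y * (x * x))
    (ω : U →ₗ[F] F) (hωmul : ∀ x y : U, ω (x * y) = ω x * ω y) (hω0 : ω ≠ 0) :
    ∃ (S : NonUnitalSubalgebra F U) (V R : Submodule F U),
      IsBSemisimpleSubalgebra F U ω S ∧
      V ≤ LinearMap.ker ω ∧
      (∀ v ∈ V, ∀ w ∈ V, v * w ∈ bRad F U ω) ∧
      (R : Set U) = bRad F U ω ∧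
      -- vector space direct sum U = S ⊕ V ⊕ rad(U)
      (S.toSubmodule ⊓ (V ⊔ R) = ⊥ ∧ V ⊓ R = ⊥ ∧
        S.toSubmodule ⊔ V ⊔ R = ⊤) ∧
      -- bar(S) is a semisimple algebra: its only nil two-sided ideal is zero
      (∀ I : Submodule F U, (I : Set U) ⊆ barSet F U ω S →
        (∀ x ∈ I, ∀ y ∈ barSet F U ω S, x * y ∈ I ∧ y * x ∈ I) →
        (∀ x ∈ I, IsNilElem x) → I = ⊥) ∧
      -- V ⊕ rad(U) is a nil two-sided ideal of bar(U)
      (∀ x ∈ V ⊔ R, IsNilElem x) ∧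
      (∀ x ∈ V ⊔ R, ∀ y : U, ω y = 0 → x * y ∈ V ⊔ R ∧ y * x ∈ V ⊔ R) := by

  have h : IsAlternative U := halt
  obtain ⟨x₀, hx₀⟩ := DFunLike.ne_iff.1 hω0
  have : Nontrivial U := ⟨x₀, 0, fun hx => hx₀ (by rw [hx, map_zero, map_zero])⟩
  obtain ⟨n, ⟨Φ⟩⟩ := h.exists_frame (F := F) (Ring.two_ne_zero hchar.1)
  obtain ⟨S, he, hinf, hsup⟩ := Φ.exists_principal_subalgebra
  obtain ⟨i₀, hi₀⟩ := Φ.exists_weight_one hωmul hω0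
  have hNω : Φ.N ≤ LinearMap.ker ω := fun x hx =>
    apply_eq_zero_of_isNilElem hωmul (Φ.isNilElem_of_mem_N hx)
  have hRN : bRadIdeal ω ≤ Φ.N := Φ.bRadIdeal_le_N hωmul
  have hR : (bRadIdeal ω : Set U) = bRad F U ω := coe_bRadIdeal hωmul (Φ.mul_self i₀) hi₀
  obtain ⟨V, hV⟩ := Submodule.exists_isCompl (bRadIdeal ω)
  have hVR : V ⊓ Φ.N ⊔ bRadIdeal ω = Φ.N := by
    rw [sup_comm, ← sup_inf_assoc_of_le _ hRN, hV.sup_eq_top, top_inf_eq]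
  refine ⟨S, V ⊓ Φ.N, bRadIdeal ω, Φ.isBSemisimpleSubalgebra he hinf hsup hωmul hi₀,
    inf_le_right.trans hNω, ?_, hR, ⟨?_, ?_, ?_⟩,
    fun I hI hmul hnil => Φ.eq_bot_of_nil_ideal_bar he hinf hsup hωmul hi₀ hI hmul hnil, ?_, ?_⟩
  · intro v hv w hw
    rw [← hR]
    exact h.mul_mem_bRadIdeal hωmul Φ.isMulIdeal_N hNω (fun x hx => Φ.isNilElem_of_mem_N hx)
      hv.2 hw.2
  · rw [hVR, hinf]
  · rw [inf_right_comm, inf_comm V, hV.inf_eq_bot, bot_inf_eq]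
  · rw [sup_assoc, hVR, hsup]
  · rw [hVR]
    exact fun x hx => Φ.isNilElem_of_mem_N hx
  · rw [hVR]
    exact fun x hx y _ => ⟨Φ.mul_right_mem_N hx y, Φ.mul_left_mem_N hx y⟩
end

section
/- Let (U, ω) be a finite-dimensional b-alternative algebra over F with unity element 1, and let J be a nil b-ideal of U. Suppose u_1, …, u_t ∈ bar(U) satisfy u_i ∉ J, u_i² − u_i ∈ J for all i, and u_i·u_j ∈ J for all i ≠ j (so the classes of the u_i are nonzero pairwise orthogonal idempotents of bar(U)/J). Then there exist nonzero pairwise orthogonal idempotents e_1, …, e_t ∈ bar(U) (e_i² = e_i, e_i·e_j = 0 for i ≠ j) with e_i − u_i ∈ J for each i. Moreover, if e is any idempotent of bar(U) with e − (u_1 + ⋯ + u_t) ∈ J, then the e_i may be chosen so that e_1 + ⋯ + e_t = e. -/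
open Polynomial

section Alternative

variable {U : Type*} [NonAssocRing U]

theorem mul_mul_swap_left (h : ∀ x y : U, (x * x) * y = x * (x * y)) (a b c : U) :
    (a * b) * c - a * (b * c) = -((b * a) * c - b * (a * c)) := by
  have hab := h (a + b) c
  simp only [mul_add, add_mul, h a c, h b c] at hab
  rw [← sub_eq_zero] at hab ⊢
  rw [← hab]
  abel

theorem mul_mul_swap_right (h : ∀ x y : U, (y * x) * x = y * (x * x)) (a b c : U) :
    (a * b) * c - a * (b * c) = -((a * c) * b - a * (c * b)) := by
  have hbc := h (b + c) a
  simp only [mul_add, add_mul, h b a, h c a] at hbc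
  rw [← sub_eq_zero] at hbc ⊢
  rw [← hbc]
  abel

variable (halt : ∀ x y : U, (x * x) * y = x * (x * y) ∧ (y * x) * x = y * (x * x))
include halt

theorem mul_mul_self_flexible (x y : U) : (x * y) * x = x * (y * x) := by
  have h := mul_mul_swap_right (fun x y => (halt x y).2) x y x
  rw [(halt x y).1, sub_self, neg_zero] at h
  exact sub_eq_zero.mp h

theorem left_moufang (x y z : U) : ((x * y) * x) * z = x * (y * (x * z)) := by
  have hl := mul_mul_swap_left fun x y => (halt x y).1
  have hr := mul_mul_swap_right fun x y => (halt x y).2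
  have h1 := hl (x * y) x z
  have h2 := hr x y (x * z)
  have h3 := hr (x * x) y z
  have h4 := congrArg (x * ·) (hr x y z)
  simp only [mul_sub, mul_neg] at h4
  rw [← (halt x y).1] at h1
  rw [← (halt x z).1] at h2
  rw [(halt x (y * z)).1, (halt x (z * y)).1] at h3
  grind

/-- Elements of the Peirce spaces `U₁₁(f)` and `U₀₀(f)` annihilate each other. -/
theorem peirce_one_mul_zero (htwo : ∀ z : U, z + z = 0 → z = 0) {f x y : U} (hf : f * f = f)
    (hfx : f * x = x) (hxf : x * f = x) (hfy : f * y = 0) : x * y = 0 := by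
  have h := mul_mul_swap_left (fun x y => (halt x y).1) x f y
  rw [hxf, hfy, hfx, mul_zero, sub_zero] at h
  have h2 : f * (x * y) = x * y + x * y := by grind
  have h3 := (halt f (x * y)).1
  rw [hf, h2, mul_add, h2] at h3
  exact htwo _ (by grind)

theorem peirce_zero_mul_one (htwo : ∀ z : U, z + z = 0 → z = 0) {f x y : U} (hf : f * f = f)
    (hfx : f * x = x) (hxf : x * f = x) (hyf : y * f = 0) : y * x = 0 := by
  have h := mul_mul_swap_right (fun x y => (halt x y).2) y f x
  rw [hxf, hyf, hfx, zero_mul, zero_sub] at h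
  have h2 : (y * x) * f = y * x + y * x := by grind
  have h3 := (halt f (y * x)).2
  rw [hf, h2, add_mul, h2] at h3
  exact htwo _ (by grind)

theorem peirce_one_mul_left {f x y : U} (hfx : f * x = x) (hxf : x * f = x) (hfy : f * y = y) :
    f * (x * y) = x * y := by
  have h := mul_mul_swap_left (fun x y => (halt x y).1) f x y
  rw [hfx, hxf, hfy, sub_self, neg_zero] at h
  exact (sub_eq_zero.mp h).symm

end Alternative

section Evaluation

variable {F U : Type*} [Field F] [NonAssocRing U] [Module F U]
  [SMulCommClass F U U]

/-- The value at `x` of a polynomial, powers being taken by left multiplication. -/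
noncomputable def leftEval (x : U) (p : F[X]) : U :=
  aeval (LinearMap.mulLeft F x) p (1 : U)

theorem leftEval_add (x : U) (p q : F[X]) :
    leftEval x (p + q) = leftEval x p + leftEval x q := by
  simp [leftEval]

theorem leftEval_sub (x : U) (p q : F[X]) :
    leftEval x (p - q) = leftEval x p - leftEval x q := by
  simp [leftEval]

theorem leftEval_X (x : U) : leftEval x (X : F[X]) = x := by
  simp [leftEval]

theorem leftEval_X_mul (x : U) (p : F[X]) : leftEval x (X * p) = x * leftEval x p := by
  simp [leftEval]

theorem leftEval_X_pow_succ (x : U) (n : ℕ) :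
    leftEval x (X ^ (n + 1) : F[X]) = x * leftEval x (X ^ n : F[X]) := by
  rw [pow_succ', leftEval_X_mul]

variable (halt : ∀ x y : U, (x * x) * y = x * (x * y) ∧ (y * x) * x = y * (x * x))
include halt

theorem leftEval_X_pow_mul (x : U) (n : ℕ) :
    ∀ y : U, leftEval x (X ^ n : F[X]) * y = (LinearMap.mulLeft F x ^ n) y := by
  induction n using Nat.twoStepInduction with
  | zero => simp [leftEval]
  | one => simp [leftEval]
  | more n ih ih1 =>
    intro y
    have hx : leftEval x (X ^ (n + 1 + 1) : F[X])
        = (x * leftEval x (X ^ n : F[X])) * x := by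
      rw [← leftEval_X_pow_succ, ih1]
      simp [leftEval, pow_succ (LinearMap.mulLeft F x) (n + 1)]
    rw [hx, left_moufang halt, ih, pow_succ', pow_succ]
    simp

theorem mul_leftEval_mul_X {f x : U} (hfx : f * x = x) (hxf : x * f = x) (p : F[X]) :
    f * leftEval x (p * X) = leftEval x (p * X) := by
  induction p using Polynomial.induction_on with
  | C a => simp [leftEval, mul_smul_comm, hfx]
  | add p q hp hq => rw [add_mul, leftEval_add, mul_add, hp, hq]
  | monomial n a h =>
    have hX : C a * X ^ (n + 1) * X = X * (C a * X ^ n * X) := by ring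
    rw [hX, leftEval_X_mul]
    exact peirce_one_mul_left halt hfx hxf h

variable [IsScalarTower F U U]

theorem leftEval_mul_right (x : U) (p : F[X]) (y : U) :
    leftEval x p * y = aeval (LinearMap.mulLeft F x) p y := by
  induction p using Polynomial.induction_on' with
  | add p q hp hq => rw [leftEval_add, add_mul, hp, hq, map_add, LinearMap.add_apply]
  | monomial n a =>
    have h := leftEval_X_pow_mul (F := F) halt x n y
    simp only [leftEval, map_pow, aeval_X] at h
    simp only [leftEval, aeval_monomial, Module.End.mul_apply,
      Module.algebraMap_end_apply, smul_mul_assoc, h]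

theorem leftEval_mul (x : U) (p q : F[X]) :
    leftEval x (p * q) = leftEval x p * leftEval x q := by
  rw [leftEval_mul_right halt]
  simp [leftEval]

theorem lpow_leftEval (x : U) (p : F[X]) (n : ℕ) :
    lpow (leftEval x p) n = leftEval x (p ^ (n + 1)) := by
  induction n with
  | zero => simp [lpow]
  | succ n ih => rw [lpow, ih, ← leftEval_mul halt, pow_succ' p (n + 1)]

theorem leftEval_mul_X_mul {f x : U} (hxf : x * f = x) (p : F[X]) :
    leftEval x (p * X) * f = leftEval x (p * X) := by
  rw [leftEval_mul_right halt]
  simp [leftEval, hxf]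

end Evaluation

theorem exists_polynomial_idempotent_lift (F : Type*) [Field F] (n : ℕ) :
    ∃ p q r s : F[X], p = q * X ∧ p - X = (X * X - X) * r ∧
      p * p - p = (X * X - X) ^ (n + 1) * s := by
  have hX1 : (X - 1 : F[X]) ∣ 1 - X ^ (n + 1) := by
    have h := sub_dvd_pow_sub_pow (X : F[X]) 1 (n + 1)
    rw [one_pow] at h
    exact (dvd_sub_comm).mp h
  have hpow : (X : F[X]) ^ (n + 1) ∣ 1 - (1 - X ^ (n + 1)) ^ (n + 1) := by
    have h := sub_dvd_pow_sub_pow (1 : F[X]) (1 - X ^ (n + 1)) (n + 1)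
    rwa [sub_sub_cancel, one_pow] at h
  have hcop : IsCoprime (X : F[X]) (X - 1) := ⟨1, -1, by ring⟩
  obtain ⟨q, hq⟩ := (dvd_pow_self X n.succ_ne_zero).trans hpow
  have hdvd : (X * (X - 1) : F[X]) ∣ 1 - (1 - X ^ (n + 1)) ^ (n + 1) - X := by
    refine hcop.mul_dvd (dvd_sub ⟨q, hq⟩ dvd_rfl) ?_
    have h := dvd_add (hX1.trans (dvd_pow_self (1 - X ^ (n + 1)) n.succ_ne_zero)) (dvd_refl (X - 1))
    rw [← dvd_neg, Nat.succ_eq_add_one] at h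
    convert h using 1
    ring
  obtain ⟨r, hr⟩ := hdvd
  obtain ⟨s, hs⟩ := mul_dvd_mul hpow (pow_dvd_pow_of_dvd hX1 (n + 1))
  refine ⟨1 - (1 - X ^ (n + 1)) ^ (n + 1), q, r, -s, by rw [hq, mul_comm], by rw [hr]; ring, ?_⟩
  rw [← mul_pow] at hs
  linear_combination -hs

section Lifting

variable {F U : Type*} [Field F] [NonAssocRing U] [Module F U]
  [SMulCommClass F U U] [IsScalarTower F U U]
  (halt : ∀ x y : U, (x * x) * y = x * (x * y) ∧ (y * x) * x = y * (x * x))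
  {J : Submodule F U} (hJideal : ∀ x ∈ J, ∀ y : U, y * x ∈ J ∧ x * y ∈ J)
  (hJnil : ∀ x ∈ J, IsNilElem x)
include halt hJideal hJnil

/-- Idempotents lift modulo a nil ideal, inside every Peirce space `U₁₁(f)` containing the
element to be lifted. -/
theorem exists_idempotent_lift {x : U} (hx : x * x - x ∈ J) :
    ∃ e : U, e * e = e ∧ e - x ∈ J ∧
      ∀ f : U, f * x = x → x * f = x → f * e = e ∧ e * f = e := by
  obtain ⟨n, hn⟩ := hJnil _ hx
  obtain ⟨p, q, r, s, hq, hr, hs⟩ := exists_polynomial_idempotent_lift F n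
  have hev : leftEval x (X * X - X : F[X]) = x * x - x := by
    rw [leftEval_sub, leftEval_X_mul, leftEval_X]
  refine ⟨leftEval x p, ?_, ?_, fun f hfx hxf => ?_⟩
  · rw [← sub_eq_zero, ← leftEval_mul halt, ← leftEval_sub, hs, leftEval_mul halt,
      ← lpow_leftEval halt, hev, hn, zero_mul]
  · have h : leftEval x p - x = (x * x - x) * leftEval x r := by
      rw [← hev, ← leftEval_mul halt, ← hr, leftEval_sub, leftEval_X]
    rw [h]
    exact (hJideal _ hx _).2
  · rw [hq]
    exact ⟨mul_leftEval_mul_X halt hfx hxf q, leftEval_mul_X_mul halt hxf q⟩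

theorem exists_orthogonal_lift_sum_eq (htwo : ∀ z : U, z + z = 0 → z = 0) (t : ℕ) :
    ∀ u : Fin t → U, (∀ i, u i * u i - u i ∈ J) → (∀ i j, i ≠ j → u i * u j ∈ J) →
      ∀ E : U, E * E = E → E - ∑ i, u i ∈ J →
        ∃ e : Fin t → U, (∀ i, e i * e i = e i ∧ e i - u i ∈ J) ∧
          (∀ i j, i ≠ j → e i * e j = 0) ∧ ∑ i, e i = E := by
  induction t with
  | zero =>
    intro u _ _ E hE hEJ
    have hpow : ∀ n, lpow E n = E := fun n => by
      induction n with
      | zero => rfl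
      | succ n ih => rw [lpow, ih, hE]
    obtain ⟨n, hn⟩ := hJnil E (by simpa using hEJ)
    exact ⟨u, fun i => i.elim0, fun i => i.elim0, by simpa using (hpow n ▸ hn).symm⟩
  | succ t ih =>
    intro u hidem horth E hE hEJ
    rw [Fin.sum_univ_succ] at hEJ
    set a := u 0
    set s := ∑ i : Fin t, u i.succ with hs
    have hsa : s * a ∈ J := by
      rw [hs, Finset.sum_mul]
      exact J.sum_mem fun i _ => horth _ _ (Fin.succ_ne_zero i)
    have has : a * s ∈ J := by
      rw [hs, Finset.mul_sum]
      exact J.sum_mem fun i _ => horth _ _ (Fin.succ_ne_zero i).symm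
    have haa : a * a - a ∈ J := hidem 0
    have hEa : E * a - a ∈ J := by
      have h := J.add_mem (J.add_mem (hJideal _ hEJ a).2 haa) hsa
      convert h using 1
      simp only [sub_mul, add_mul]
      abel
    have hwa : E * a * E - a ∈ J := by
      have h := J.add_mem (J.add_mem (J.add_mem (hJideal _ hEa E).2 (hJideal _ hEJ a).1) haa) has
      convert h using 1
      simp only [sub_mul, mul_sub, mul_add]
      abel
    set w := E * a * E with hw
    have hww : w * w - w ∈ J := by
      have h := J.sub_mem
        (J.add_mem (J.add_mem (hJideal _ hwa w).2 (hJideal _ hwa a).1) haa) hwa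
      convert h using 1
      simp only [sub_mul, mul_sub]
      abel
    have hEw : E * w = w := by
      rw [hw, mul_mul_self_flexible halt, ← (halt E _).1, hE]
    have hwE : w * E = w := by rw [hw, (halt E _).2, hE]
    obtain ⟨e₀, he₀, he₀w, hpeirce⟩ := exists_idempotent_lift halt hJideal hJnil hww
    obtain ⟨hEe, heE⟩ := hpeirce E hEw hwE
    have he₀a : e₀ - a ∈ J := by simpa using J.add_mem he₀w hwa
    have hfidem : (E - e₀) * (E - e₀) = E - e₀ := by
      simp only [sub_mul, mul_sub, hE, hEe, heE, he₀]
      abel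
    obtain ⟨e, he, heorth, hesum⟩ := ih (fun i => u i.succ) (fun i => hidem _)
      (fun i j hij => horth _ _ (by simpa using hij)) (E - e₀) hfidem (by
        convert J.sub_mem hEJ he₀a using 1
        abel)
    have hfe : ∀ i, (E - e₀) * e i = e i := fun i => by
      rw [← hesum, Finset.sum_mul, Finset.sum_eq_single i (fun j _ hj => heorth _ _ hj) (by simp)]
      exact (he i).1
    have hef : ∀ i, e i * (E - e₀) = e i := fun i => by
      rw [← hesum, Finset.mul_sum,
        Finset.sum_eq_single i (fun j _ hj => heorth _ _ hj.symm) (by simp)]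
      exact (he i).1
    have hfe₀ : (E - e₀) * e₀ = 0 := by rw [sub_mul, hEe, he₀, sub_self]
    have he₀f : e₀ * (E - e₀) = 0 := by rw [mul_sub, heE, he₀, sub_self]
    refine ⟨Fin.cons e₀ e, fun i => ?_, fun i j hij => ?_, ?_⟩
    · cases i using Fin.cases with
      | zero => exact ⟨he₀, he₀a⟩
      | succ i => exact he i
    · cases i using Fin.cases with
      | zero =>
        cases j using Fin.cases with
        | zero => exact absurd rfl hij
        | succ j => exact peirce_zero_mul_one halt htwo hfidem (hfe j) (hef j) he₀f
      | succ i =>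
        cases j using Fin.cases with
        | zero => exact peirce_one_mul_zero halt htwo hfidem (hfe i) (hef i) hfe₀
        | succ j => exact heorth i j (by simpa using hij)
    · rw [Fin.sum_cons, hesum]
      abel

end Lifting

/-- Let `(U, ω)` be a finite-dimensional b-alternative algebra over `F` with
unity element `1` and `J` a nil b-ideal of `U`.  If the classes of
`u_1, …, u_t ∈ bar(U)` are nonzero pairwise orthogonal idempotents of
`bar(U)/J`, then there exist nonzero pairwise orthogonal idempotents
`e_1, …, e_t ∈ bar(U)` with `e_i − u_i ∈ J`; moreover, for any idempotent `e`
of `bar(U)` with `e − (u_1 + ⋯ + u_t) ∈ J` the `e_i` may be chosen with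
`e_1 + ⋯ + e_t = e`. -/
theorem orthogonal_idempotent_lifting
    (F : Type*) [Field F]
    (hchar : ringChar F ≠ 2 ∧ ringChar F ≠ 3 ∧ ringChar F ≠ 5)
    (U : Type*) [NonAssocRing U] [Module F U]
    [SMulCommClass F U U] [IsScalarTower F U U] [FiniteDimensional F U]
    (halt : ∀ x y : U, (x * x) * y = x * (x * y) ∧ (y * x) * x = y * (x * x))
    (ω : U →ₗ[F] F) (hωmul : ∀ x y : U, ω (x * y) = ω x * ω y) (hω0 : ω ≠ 0)
    (J : Submodule F U)
    (hJbar : ∀ x ∈ J, ω x = 0)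
    (hJideal : ∀ x ∈ J, ∀ y : U, y * x ∈ J ∧ x * y ∈ J)
    (hJnil : ∀ x ∈ J, IsNilElem x)
    (t : ℕ) (u : Fin t → U)
    (hubar : ∀ i, ω (u i) = 0) (huJ : ∀ i, u i ∉ J)
    (huidem : ∀ i, u i * u i - u i ∈ J)
    (huorth : ∀ i j, i ≠ j → u i * u j ∈ J) :
    (∃ e : Fin t → U,
      (∀ i, ω (e i) = 0 ∧ e i ≠ 0 ∧ e i * e i = e i ∧ e i - u i ∈ J) ∧
      (∀ i j, i ≠ j → e i * e j = 0)) ∧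
    (∀ E : U, ω E = 0 → E * E = E → E - ∑ i, u i ∈ J →
      ∃ e : Fin t → U,
        (∀ i, ω (e i) = 0 ∧ e i ≠ 0 ∧ e i * e i = e i ∧ e i - u i ∈ J) ∧
        (∀ i j, i ≠ j → e i * e j = 0) ∧
        ∑ i, e i = E) := by
  have htwo : ∀ z : U, z + z = 0 → z = 0 := fun z hz => by
    rw [← two_smul F] at hz
    exact (smul_eq_zero.mp hz).resolve_left (Ring.two_ne_zero hchar.1)
  have hlift : ∀ E : U, E * E = E → E - ∑ i, u i ∈ J →
      ∃ e : Fin t → U,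
        (∀ i, ω (e i) = 0 ∧ e i ≠ 0 ∧ e i * e i = e i ∧ e i - u i ∈ J) ∧
        (∀ i j, i ≠ j → e i * e j = 0) ∧
        ∑ i, e i = E := fun E hE hEJ => by
    obtain ⟨e, he, horth, hsum⟩ := exists_orthogonal_lift_sum_eq halt hJideal hJnil htwo t u
      huidem huorth E hE hEJ
    refine ⟨e, fun i => ⟨?_, fun h => huJ i ?_, he i⟩, horth, hsum⟩
    · have h := hJbar _ (he i).2
      rwa [map_sub, hubar, sub_zero] at h
    · simpa [h] using (he i).2
  refine ⟨?_, fun E _ => hlift E⟩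
  have hsum : (∑ i, u i) * (∑ i, u i) - ∑ i, u i ∈ J := by
    rw [Finset.sum_mul, ← Finset.sum_sub_distrib]
    refine J.sum_mem fun i _ => ?_
    rw [Finset.mul_sum, ← Finset.add_sum_erase _ _ (Finset.mem_univ i), add_sub_right_comm]
    exact J.add_mem (huidem i) (J.sum_mem fun j hj => huorth i j (Finset.ne_of_mem_erase hj).symm)
  obtain ⟨E, hE, hEJ, -⟩ := exists_idempotent_lift halt hJideal hJnil hsum
  obtain ⟨e, he, horth, -⟩ := hlift E hE hEJ
  exact ⟨e, he, horth⟩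
end
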